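/- arXiv:0809.4169 — 6 statements merged into one kernel-verified Lean document; each statement's English description precedes it below -/
import Mathlib

section
/- Let B = ℚ[X]_{(X)}, A = ℤ + XB, and E = A/XB ≅ ℤ. Then E has flat dimension at most 1 over A but projective dimension strictly greater than 1 over A; in particular, A is not a strong 1-perfect ring. -/
open CategoryTheory CategoryTheory.Limits

noncomputable section

universe u

/-- `pdLE R M n` : the projective dimension of the `R`-module `M` is at most `n`,
expressed by the vanishing of `Ext^{n+1}(M, N)` for all `N`. -/
def pdLE (R : Type u) [CommRing R] (M : Type u) [AddCommGroup M] [Module R M] (n : ℕ) : Prop :=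
  ∀ N : ModuleCat.{u} R,
    IsZero (((Ext R (ModuleCat.{u} R) (n + 1)).obj (Opposite.op (ModuleCat.of R M))).obj N)

/-- `fdLE R M n` : the flat dimension of the `R`-module `M` is at most `n`,
expressed by the vanishing of `Tor_{n+1}(M, N)` for all `N`. -/
def fdLE (R : Type u) [CommRing R] (M : Type u) [AddCommGroup M] [Module R M] (n : ℕ) : Prop :=
  ∀ N : ModuleCat.{u} R,
    IsZero (((Tor' (ModuleCat.{u} R) (n + 1)).obj (ModuleCat.of R M)).obj N)

/-- A commutative ring `R` is strong `n`-perfect if every `R`-module of flat dimension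
at most `n` has projective dimension at most `n`. -/
def IsStrongNPerfect (R : Type u) [CommRing R] (n : ℕ) : Prop :=
  ∀ (M : Type u) [AddCommGroup M] [Module R M], fdLE R M n → pdLE R M n

universe v

section splice
variable {C : Type u} [Category.{v} C] [Abelian C]

/-- A projective resolution from exactness data. -/
def resOfExact (K : ChainComplex C ℕ) (hproj : ∀ n, Projective (K.X n)) {Z : C} (p : K.X 0 ⟶ Z)
    (w : K.d 1 0 ≫ p = 0) (h0 : (ShortComplex.mk _ _ w).Exact) (hp : Epi p)
    (h : ∀ n, K.ExactAt (n + 1)) : ProjectiveResolution Z where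
  complex := K
  projective := hproj
  π := (ChainComplex.toSingle₀Equiv K Z).symm ⟨p, w⟩
  quasiIso := ⟨fun n => by
    match n with
    | 0 =>
      rw [ChainComplex.quasiIsoAt₀_iff, ShortComplex.quasiIso_iff_of_zeros']
      · refine (ShortComplex.exact_and_epi_g_iff_of_iso ?_).2 ⟨h0, hp⟩
        refine ShortComplex.isoMk (Iso.refl _) (Iso.refl _) (Iso.refl _) ?_ ?_
        · exact (Category.id_comp _).trans (Category.comp_id _).symm
        · refine (Category.id_comp _).trans (Eq.trans ?_ (Category.comp_id _).symm)
          exact (ChainComplex.toSingle₀Equiv_symm_apply_f_zero p w).symm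
      · exact K.shape 0 0 (by simp)
      all_goals rfl
    | n + 1 =>
      rw [quasiIsoAt_iff_exactAt']
      · exact h n
      · apply ChainComplex.exactAt_succ_single_obj⟩

/-- The augmentation of a projective resolution. -/
def augMap {Z : C} (Q : ProjectiveResolution Z) : Q.complex.X 0 ⟶ Z := Q.π.f 0

lemma augMap_w {Z : C} (Q : ProjectiveResolution Z) : Q.complex.d 1 0 ≫ augMap Q = 0 :=
  Q.complex_d_comp_π_f_zero

lemma augMap_exact {Z : C} (Q : ProjectiveResolution Z) :
    (ShortComplex.mk _ _ (augMap_w Q)).Exact :=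
  ShortComplex.exact_of_g_is_cokernel (ShortComplex.mk _ _ Q.complex_d_comp_π_f_zero)
    Q.isColimitCokernelCofork

lemma augMap_epi {Z : C} (Q : ProjectiveResolution Z) : Epi (augMap Q) :=
  inferInstanceAs (Epi (Q.π.f 0))

/-- Splicing a projective resolution of the kernel. -/
def spliceRes (S : ShortComplex C) (hS : S.ShortExact) [Projective S.X₂]
    (Q : ProjectiveResolution S.X₁) : ProjectiveResolution S.X₃ :=
  resOfExact (ChainComplex.augment Q.complex (augMap Q ≫ S.f) (by
    rw [← Category.assoc, augMap_w, zero_comp]))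
    (fun n => match n with
      | 0 => (inferInstance : Projective S.X₂)
      | n + 1 => (inferInstance : Projective (Q.complex.X n)))
    S.g (show (augMap Q ≫ S.f) ≫ S.g = 0 by rw [Category.assoc, S.zero, comp_zero])
    (by
      have := augMap_epi Q
      let φ : ShortComplex.mk (augMap Q ≫ S.f) S.g
          (by rw [Category.assoc, S.zero, comp_zero]) ⟶ S :=
        { τ₁ := augMap Q, τ₂ := 𝟙 _, τ₃ := 𝟙 _ }
      have : Epi φ.τ₁ := inferInstanceAs (Epi (augMap Q))
      have : IsIso φ.τ₂ := inferInstanceAs (IsIso (𝟙 _))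
      have : Mono φ.τ₃ := inferInstanceAs (Mono (𝟙 _))
      exact (ShortComplex.exact_iff_of_epi_of_isIso_of_mono φ).2 hS.exact)
    hS.epi_g
    (fun n => by
      match n with
      | 0 =>
        rw [HomologicalComplex.exactAt_iff' _ 2 1 0 (by simp) (by simp)]
        have := hS.mono_f
        let φ : ShortComplex.mk _ _ (augMap_w Q) ⟶
            ShortComplex.mk (Q.complex.d 1 0) (augMap Q ≫ S.f) (by
              rw [← Category.assoc, augMap_w, zero_comp]) :=
            { τ₁ := 𝟙 _, τ₂ := 𝟙 _, τ₃ := S.f }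
        have : Epi φ.τ₁ := inferInstanceAs (Epi (𝟙 _))
        have : IsIso φ.τ₂ := inferInstanceAs (IsIso (𝟙 _))
        have : Mono φ.τ₃ := inferInstanceAs (Mono S.f)
        exact (ShortComplex.exact_iff_of_epi_of_isIso_of_mono φ).1 (augMap_exact Q)
      | n + 1 =>
        rw [HomologicalComplex.exactAt_iff' _ (n+3) (n+2) (n+1) (by simp) (by simp)]
        exact Q.exact_succ n)

lemma isZero_leftDerived_two_iff {D : Type*} [Category* D] [Abelian D]
    [HasProjectiveResolutions C] (F : C ⥤ D) [F.Additive]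
    (S : ShortComplex C) (hS : S.ShortExact) [Projective S.X₂]
    (Q : ProjectiveResolution S.X₁) :
    IsZero ((F.leftDerived 2).obj S.X₃) ↔
      (ShortComplex.mk (F.map (Q.complex.d 2 1)) (F.map (Q.complex.d 1 0))
        (by rw [← F.map_comp, Q.complex.d_comp_d, F.map_zero])).Exact := by
  rw [((spliceRes S hS Q).isoLeftDerivedObj F 2).isZero_iff]
  change IsZero (HomologicalComplex.homology _ 2) ↔ _
  rw [← HomologicalComplex.exactAt_iff_isZero_homology,
    HomologicalComplex.exactAt_iff' _ 3 2 1 (by simp) (by simp)]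
  rfl

end splice


lemma tensor_exact_aux {R : Type*} [CommRing R] {P2 P1 P0 M : Type*} [AddCommGroup P2]
    [AddCommGroup P1] [AddCommGroup P0] [AddCommGroup M] [Module R P2] [Module R P1] [Module R P0]
    [Module R M] [Module.Flat R M] (d2 : P2 →ₗ[R] P1) (d1 : P1 →ₗ[R] P0) (p : P0 →ₗ[R] M)
    (h2 : Function.Exact d2 d1) (h1 : Function.Exact d1 p) (hp : Function.Surjective p)
    (N : Type*) [AddCommGroup N] [Module R N] :
    Function.Exact (d2.rTensor N) (d1.rTensor N) := by
  have e1 : Function.Exact d2 d1.rangeRestrict := by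
    intro x
    rw [← h2 x]
    simp [Subtype.ext_iff]
  have e2 := rTensor_exact N e1 d1.surjective_rangeRestrict
  have e3 : Function.Injective ((LinearMap.range d1).subtype.rTensor N) := by
    rw [← LinearMap.lTensor_inj_iff_rTensor_inj]
    refine LinearMap.lTensor_injective_of_exact_of_flat p hp _ (Submodule.subtype_injective _) ?_ N
    intro x
    rw [h1 x]
    simp
  have e4 : d1.rTensor N = (LinearMap.range d1).subtype.rTensor N ∘ₗ
      d1.rangeRestrict.rTensor N := by
    rw [← LinearMap.rTensor_comp]; rfl
  intro x
  rw [← e2 x, e4, LinearMap.comp_apply]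
  exact map_eq_zero_iff _ e3

lemma proj_aux {R : Type*} [CommRing R] {P2 P1 P0 M : Type*} [AddCommGroup P2]
    [AddCommGroup P1] [AddCommGroup P0] [AddCommGroup M] [Module R P2] [Module R P1] [Module R P0]
    [Module R M] [Module.Projective R P0] (d2 : P2 →ₗ[R] P1) (d1 : P1 →ₗ[R] P0) (p : P0 →ₗ[R] M)
    (h2 : Function.Exact d2 d1) (h1 : Function.Exact d1 p) (hp : Function.Surjective p)
    (H : ∀ φ : P1 →ₗ[R] LinearMap.range d1, φ ∘ₗ d2 = 0 →
      ∃ ψ : P0 →ₗ[R] LinearMap.range d1, ψ ∘ₗ d1 = φ) : Module.Projective R M := by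
  obtain ⟨ψ, hψ⟩ := H d1.rangeRestrict (by
    ext x; simpa using (h2 _).2 ⟨x, rfl⟩)
  have h3 : Function.Exact (LinearMap.range d1).subtype p := by
    intro x
    rw [h1 x]
    simp
  have h4 : ∃ l, l ∘ₗ (LinearMap.range d1).subtype = LinearMap.id := by
    refine ⟨ψ, ?_⟩
    ext ⟨_, x, rfl⟩
    have := congrArg Subtype.val (LinearMap.congr_fun hψ x)
    simpa using this
  have h5 : _ ∧ _ := (h3.split_tfae'.out 1 0).1 (And.intro hp h4)
  obtain ⟨s, hs⟩ := h5.2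
  exact Module.Projective.of_split s p hs

section ideal
variable (R : Type u) [CommRing R] (I : Ideal R)

/-- the sequence `I → R → R/I` -/
def idealSC : ShortComplex (ModuleCat.{u} R) := ShortComplex.mk (X₁ := ModuleCat.of R I)
    (X₂ := ModuleCat.of R R) (X₃ := ModuleCat.of R (R ⧸ I))
    (ModuleCat.ofHom I.subtype) (ModuleCat.ofHom (Submodule.mkQ I)) (by
      ext x
      exact (Submodule.Quotient.mk_eq_zero I).2 x.2)

lemma idealSC_shortExact : (idealSC R I).ShortExact where
  exact := by
    rw [ShortComplex.moduleCat_exact_iff]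
    intro x hx
    exact ⟨⟨x, (Submodule.Quotient.mk_eq_zero I).1 hx⟩, rfl⟩
  mono_f := (ModuleCat.mono_iff_injective _).2 (Submodule.subtype_injective I)
  epi_g := (ModuleCat.epi_iff_surjective _).2 (Submodule.mkQ_surjective I)

instance : Projective (idealSC R I).X₂ :=
  inferInstanceAs (Projective (ModuleCat.of R R))

lemma res_facts {M : ModuleCat.{u} R} (Q : ProjectiveResolution M) :
    ∃ p : Q.complex.X 0 →ₗ[R] M,
    Function.Exact (Q.complex.d 2 1).hom (Q.complex.d 1 0).hom ∧
    Function.Exact (Q.complex.d 1 0).hom p ∧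
    Function.Surjective p := by
  refine ⟨(Q.π.f 0).hom, (ShortComplex.ShortExact.moduleCat_exact_iff_function_exact _).1 (Q.exact_succ 0),
    (ShortComplex.ShortExact.moduleCat_exact_iff_function_exact _).1
      (ShortComplex.exact_of_g_is_cokernel (ShortComplex.mk _ _ Q.complex_d_comp_π_f_zero)
        Q.isColimitCokernelCofork), ?_⟩
  exact (ModuleCat.epi_iff_surjective _).1 inferInstance

theorem flat_side [Module.Flat R I] (N : ModuleCat.{u} R) :
    IsZero (((Tor' (ModuleCat.{u} R) 2).obj (ModuleCat.of R (R ⧸ I))).obj N) := by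
  let Q : ProjectiveResolution (idealSC R I).X₁ := ProjectiveResolution.of _
  refine (isZero_leftDerived_two_iff ((MonoidalCategory.tensoringRight _).obj N) _
    (idealSC_shortExact R I) Q).2 ?_
  rw [ShortComplex.ShortExact.moduleCat_exact_iff_function_exact]
  obtain ⟨p, h2, h1, h0⟩ := res_facts R Q
  have : Module.Flat R (idealSC R I).X₁ := inferInstanceAs (Module.Flat R I)
  exact tensor_exact_aux (M := (idealSC R I).X₁) _ _ p h2 h1 h0 N

theorem proj_side
    (h : ∀ N : ModuleCat.{u} R, IsZero (((Ext R (ModuleCat.{u} R) 2).obj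
      (Opposite.op (ModuleCat.of R (R ⧸ I)))).obj N)) :
    Module.Projective R I := by
  let Q : ProjectiveResolution (idealSC R I).X₁ := ProjectiveResolution.of _
  obtain ⟨p, h2, h1, h0⟩ := res_facts R Q
  have : Module.Projective R (Q.complex.X 0) :=
    (IsProjective.iff_projective (R := R) (Q.complex.X 0)).2 (Q.projective 0)
  refine proj_aux (M := (idealSC R I).X₁) _ _ p h2 h1 h0 ?_
  intro φ hφ
  let N := ModuleCat.of R (LinearMap.range (Q.complex.d 1 0).hom)
  have key := ((isZero_leftDerived_two_iff ((linearYoneda R (ModuleCat R)).obj N).rightOp _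
    (idealSC_shortExact R I) Q).1 (h N).op).unop
  rw [ShortComplex.moduleCat_exact_iff] at key
  obtain ⟨ψ, hψ⟩ := key (ModuleCat.ofHom φ : Q.complex.X 1 ⟶ N) (by
    change Q.complex.d 2 1 ≫ ModuleCat.ofHom φ = 0
    exact ModuleCat.hom_ext hφ)
  refine ⟨ModuleCat.Hom.hom (ψ : Q.complex.X 0 ⟶ N), ?_⟩
  exact congrArg ModuleCat.Hom.hom (show Q.complex.d 1 0 ≫ (ψ : Q.complex.X 0 ⟶ N) = _ from hψ)
end ideal

section concrete

lemma flat_B {B : Type*} [CommRing B] (x : B)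
    (hint : ∀ n : ℤ, n ≠ 0 → IsUnit (n : B))
    (hq : ∀ b : B, ∃ n : ℤ, n ≠ 0 ∧ ∃ k : ℤ, x ∣ n * b - k)
    (A : Subring B)
    (hA : ∀ y : B, y ∈ A ↔ ∃ n : ℤ, x ∣ y - n) : Module.Flat A B := by
  let S : Submonoid A := (nonZeroDivisors ℤ).map (Int.castRingHom A)
  have : IsLocalization S B := by
    refine (isLocalization_iff _ _).2 ⟨?_, ?_, ?_⟩
    · rintro ⟨_, n, hn, rfl⟩
      have := hint n (nonZeroDivisors.ne_zero hn)
      simpa using this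
    · intro b
      obtain ⟨n, hn, k, hk⟩ := hq b
      refine ⟨(⟨n * b, (hA _).2 ⟨k, hk⟩⟩, ⟨_, n, mem_nonZeroDivisors_of_ne_zero hn, rfl⟩), ?_⟩
      change b * algebraMap A B (Int.castRingHom A n) = n * b
      simp [mul_comm]
    · intro a b h
      exact ⟨1, by simpa using Subtype.ext h⟩
  exact IsLocalization.flat B S

lemma flat_M {B : Type*} [CommRing B] [IsDomain B] (x : B)
    (hx0 : x ≠ 0)
    (hint : ∀ n : ℤ, n ≠ 0 → IsUnit (n : B))
    (hq : ∀ b : B, ∃ n : ℤ, n ≠ 0 ∧ ∃ k : ℤ, x ∣ n * b - k)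
    (A : Subring B)
    (hA : ∀ y : B, y ∈ A ↔ ∃ n : ℤ, x ∣ y - n)
    (M : Ideal A)
    (hM : ∀ y : A, y ∈ M ↔ x ∣ (y : B)) : Module.Flat A M := by
  have := flat_B x hint hq A hA
  have hmem : ∀ b : B, x * b ∈ A := fun b => (hA _).2 ⟨0, by simp⟩
  let f : B →ₗ[A] M :=
    { toFun := fun b => ⟨⟨x * b, hmem b⟩, (hM _).2 (dvd_mul_right _ _)⟩
      map_add' := fun a b => by
        apply Subtype.ext; apply Subtype.ext
        exact mul_add _ _ _
      map_smul' := fun a b => by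
        apply Subtype.ext; apply Subtype.ext
        exact mul_left_comm x (a : B) b }
  refine Module.Flat.of_linearEquiv (LinearEquiv.ofBijective f ⟨?_, ?_⟩).symm
  · intro a b h
    have h' : x * a = x * b := congrArg (fun m : M => ((m : A) : B)) h
    exact mul_left_cancel₀ hx0 h'
  · rintro ⟨⟨y, hy⟩, hy'⟩
    obtain ⟨b, rfl⟩ := (hM _).1 hy'
    exact ⟨b, rfl⟩

lemma divisible_mem {B : Type*} [CommRing B] (x : B)
    (hxu : ¬ IsUnit x)
    (hint : ∀ n : ℤ, n ≠ 0 → IsUnit (n : B))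
    (A : Subring B)
    (hA : ∀ y : B, y ∈ A ↔ ∃ n : ℤ, x ∣ y - n)
    (M : Ideal A)
    (hM : ∀ y : A, y ∈ M ↔ x ∣ (y : B))
    (c : A) (hc : ∀ n : ℤ, n ≠ 0 → ∃ a : A, c = n * a) : c ∈ M := by
  rw [hM]
  obtain ⟨k, hk⟩ := (hA _).1 c.2
  have hint0 : ∀ n : ℤ, x ∣ (n : B) → n = 0 := by
    intro n hn
    by_contra h
    exact hxu (isUnit_of_dvd_unit hn (hint n h))
  suffices k = 0 by simpa [this] using hk
  by_contra hk0
  obtain ⟨a, ha⟩ := hc (2 * k) (by simpa using hk0)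
  obtain ⟨j, hj⟩ := (hA _).1 a.2
  have hc' : (c : B) = 2 * k * a := by
    rw [ha, Subring.coe_mul, Subring.coe_intCast]
    push_cast
    rfl
  have h1 : x ∣ ((2 * k * j - k : ℤ) : B) := by
    have h2 := dvd_sub hk (hj.mul_left (2 * k : B))
    rw [hc'] at h2
    convert h2 using 1
    push_cast
    ring
  have h2 := hint0 _ h1
  have h3 : k * (2 * j - 1) = 0 := by linear_combination h2
  rcases mul_eq_zero.1 h3 with h | h
  · exact hk0 h
  · omega

lemma not_proj_M {B : Type*} [CommRing B] [IsDomain B] (x : B)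
    (hx0 : x ≠ 0)
    (hxu : ¬ IsUnit x)
    (hint : ∀ n : ℤ, n ≠ 0 → IsUnit (n : B))
    (A : Subring B)
    (hA : ∀ y : B, y ∈ A ↔ ∃ n : ℤ, x ∣ y - n)
    (M : Ideal A)
    (hM : ∀ y : A, y ∈ M ↔ x ∣ (y : B)) : ¬ Module.Projective A M := by
  intro hproj
  obtain ⟨s, hs⟩ := Module.projective_def'.1 hproj
  have hmem : ∀ b : B, x * b ∈ A := fun b => (hA _).2 ⟨0, by simp⟩
  let e : B → M := fun b => ⟨⟨x * b, hmem b⟩, (hM _).2 (dvd_mul_right _ _)⟩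
  have hc : ∀ i, s (e 1) i ∈ M := by
    intro i
    refine divisible_mem x hxu hint A hA M hM _ fun n hn => ?_
    obtain ⟨u, hu⟩ := (hint n hn).exists_right_inv
    have : e 1 = (n : A) • e u := by
      apply Subtype.ext; apply Subtype.ext
      change x * 1 = ((n : A) : B) * (x * u)
      push_cast
      rw [mul_left_comm, hu]
    exact ⟨s (e u) i, by rw [this, map_smul]; simp⟩
  have h1 : Finsupp.linearCombination A id (s (e 1)) = e 1 := LinearMap.congr_fun hs (e 1)
  have h2 : x * x ∣ x * 1 := by
    have h3 : ((e 1 : M) : A) = (s (e 1)).sum fun i c => c * (i : A) := by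
      conv_lhs => rw [← h1]
      simp [Finsupp.linearCombination_apply, Finsupp.sum]
    have h4 : x * 1 = (s (e 1)).sum fun i c => (c : B) * ((i : A) : B) := by
      have := congrArg (Subtype.val) h3
      simpa [Finsupp.sum, e] using this
    rw [h4]
    refine Finset.dvd_sum fun i _ => mul_dvd_mul ((hM _).1 (hc i)) ((hM _).1 i.2)
  exact hxu (isUnit_of_dvd_one ((mul_dvd_mul_iff_left hx0).1 h2))
end concrete

theorem localization_facts     (P : Ideal (Polynomial ℚ)) (hP : P = Ideal.span {Polynomial.X}) [P.IsPrime] :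
   ∃ x : Localization.AtPrime P,  P.map (algebraMap (Polynomial ℚ) (Localization.AtPrime P)) = Ideal.span {x} ∧ x ≠ 0 ∧ ¬ IsUnit x ∧
  (∀ n : ℤ, n ≠ 0 → IsUnit (n : Localization.AtPrime P)) ∧
  (∀ b : Localization.AtPrime P, ∃ n : ℤ, n ≠ 0 ∧ ∃ k : ℤ, x ∣ n * b - k) := by
  have hPmem : ∀ f : Polynomial ℚ, f ∈ P ↔ f.coeff 0 = 0 := by
    intro f
    rw [hP, Ideal.mem_span_singleton, Polynomial.X_dvd_iff]
  have hmap : P.map (algebraMap (Polynomial ℚ) (Localization.AtPrime P)) =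
      Ideal.span {algebraMap (Polynomial ℚ) (Localization.AtPrime P) Polynomial.X} := by
    have key : ∀ J : Ideal (Polynomial ℚ), J = Ideal.span {Polynomial.X} →
        J.map (algebraMap (Polynomial ℚ) (Localization.AtPrime P)) =
        Ideal.span {algebraMap (Polynomial ℚ) (Localization.AtPrime P) Polynomial.X} := by
      rintro _ rfl
      rw [Ideal.map_span, Set.image_singleton]
    exact key P hP
  have hcu : ∀ s : Polynomial ℚ, s.coeff 0 ≠ 0 →
      IsUnit (algebraMap (Polynomial ℚ) (Localization.AtPrime P) s) := by
    intro s hs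
    exact IsLocalization.map_units (M := P.primeCompl) _ ⟨s, fun h => hs ((hPmem s).1 h)⟩
  refine ⟨algebraMap _ _ Polynomial.X, hmap, ?_, ?_, ?_, ?_⟩
  · rw [Ne, IsLocalization.to_map_eq_zero_iff (M := P.primeCompl) _ P.primeCompl_le_nonZeroDivisors]
    exact Polynomial.X_ne_zero
  · rw [IsLocalization.AtPrime.isUnit_to_map_iff (Localization.AtPrime P) P]
    simp [Ideal.primeCompl, hPmem]
  · intro n hn
    have := hcu (n : Polynomial ℚ) (by simpa using hn)
    simpa using this
  · intro b
    obtain ⟨⟨f, s⟩, hfs⟩ := IsLocalization.surj P.primeCompl b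
    simp only at hfs
    have hs : (s : Polynomial ℚ).coeff 0 ≠ 0 := fun h => s.2 ((hPmem _).2 h)
    let q : ℚ := f.coeff 0 / (s : Polynomial ℚ).coeff 0
    refine ⟨q.den, by exact_mod_cast q.den_ne_zero, q.num, ?_⟩
    have hu := hcu s hs
    rw [← hu.dvd_mul_right]
    have h1 : (Polynomial.X : Polynomial ℚ) ∣ (q.den : Polynomial ℚ) * f - (q.num : Polynomial ℚ) * s := by
      rw [Polynomial.X_dvd_iff]
      have : f.coeff 0 = q * (s : Polynomial ℚ).coeff 0 := by simp [q, hs]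
      have h3 : (q.den : ℚ) * q = q.num := Rat.den_mul_eq_num q
      simp [Polynomial.mul_coeff_zero, this]
      rw [← h3]; ring
    have h2 := map_dvd (algebraMap (Polynomial ℚ) (Localization.AtPrime P)) h1
    convert h2 using 1
    rw [map_sub, map_mul, map_mul, ← hfs]
    simp
    ring

set_option synthInstance.maxHeartbeats 1000000 in
set_option maxHeartbeats 2000000 in
/-- For `B = ℚ[X]_{(X)}`, `A = ℤ + XB` and `E = A/XB ≅ ℤ`, the module `E` has flat
dimension at most 1 but projective dimension greater than 1 over `A`; in particular
`A` is not strong 1-perfect. -/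
theorem zPlusXB_not_strongOnePerfect
    (P : Ideal (Polynomial ℚ)) (hP : P = Ideal.span {Polynomial.X}) [P.IsPrime]
    (A : Subring (Localization.AtPrime P))
    (hA : ∀ x : Localization.AtPrime P,
      x ∈ A ↔ ∃ n : ℤ, x - (n : Localization.AtPrime P) ∈
        P.map (algebraMap (Polynomial ℚ) (Localization.AtPrime P)))
    (M : Ideal A)
    (hM : ∀ y : A, y ∈ M ↔ (y : Localization.AtPrime P) ∈
        P.map (algebraMap (Polynomial ℚ) (Localization.AtPrime P))) :
    fdLE A (A ⧸ M) 1 ∧ ¬ pdLE A (A ⧸ M) 1 ∧ ¬ IsStrongNPerfect A 1 := by 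
  obtain ⟨x, hspan, hx0, hxu, hint, hq⟩ := localization_facts P hP
  have hA' : ∀ y : Localization.AtPrime P, y ∈ A ↔ ∃ n : ℤ, x ∣ y - n := by
    intro y
    rw [hA, hspan]
    simp only [Ideal.mem_span_singleton]
  have hM' : ∀ y : A, y ∈ M ↔ x ∣ (y : Localization.AtPrime P) := by
    intro y
    rw [hM, hspan, Ideal.mem_span_singleton]
  have hflat : Module.Flat A M := flat_M x hx0 hint hq A hA' M hM'
  have h1 : fdLE A (A ⧸ M) 1 := fun N => flat_side A M N
  have h2 : ¬ pdLE A (A ⧸ M) 1 := fun h =>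
    not_proj_M x hx0 hxu hint A hA' M hM' (proj_side A M h)
  exact ⟨h1, h2, fun h => h2 (h _ h1)⟩
end
end

section
/- Let A ↪ B be an injective flat ring homomorphism of commutative rings and Q an ideal of A with QB = Q. If B is an n-perfect ring and A/Q is an n-perfect ring, then A is an n-perfect ring. -/
open CategoryTheory CategoryTheory.Limits

noncomputable section

universe u

/-- A commutative ring `R` is `n`-perfect if every flat `R`-module has projective
dimension at most `n`. -/
def IsNPerfect (R : Type u) [CommRing R] (n : ℕ) : Prop :=
  ∀ (M : Type u) [AddCommGroup M] [Module R M], Module.Flat R M → pdLE R M n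

section Helpers

open TensorProduct

lemma aux_bridge (R : Type u) [CommRing R] (M N : ModuleCat.{u} R) (m : ℕ) :
    IsZero (((Ext R (ModuleCat.{u} R) (m + 1)).obj (Opposite.op M)).obj N) ↔
      Subsingleton (Abelian.Ext.{u} M N (m + 1)) := by
  let P := ProjectiveResolution.of M
  rw [(P.isoExt (R := R) (m + 1) N).isZero_iff,
    ← HomologicalComplex.exactAt_iff_isZero_homology,
    HomologicalComplex.exactAt_iff' _ m (m + 1) (m + 2) (by simp) (by simp),
    ShortComplex.moduleCat_exact_iff]
  constructor
  · intro h
    refine subsingleton_of_forall_eq 0 fun α ↦ ?_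
    obtain ⟨f, hf, rfl⟩ := P.extMk_surjective α (m + 2) rfl
    rw [P.extMk_eq_zero_iff f (m + 2) rfl hf m rfl]
    obtain ⟨g, hg⟩ := h f hf
    exact ⟨g, hg⟩
  · intro h f hf
    have := (P.extMk_eq_zero_iff f (m + 2) rfl hf m rfl).1 (Subsingleton.elim _ _)
    exact this

lemma aux_pd (R : Type u) [CommRing R] (M : ModuleCat.{u} R) (n : ℕ)
    (h : ∀ N : ModuleCat.{u} R, Subsingleton (Abelian.Ext.{u} M N (n + 1))) :
    HasProjectiveDimensionLT M (n + 1) :=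
  hasProjectiveDimensionLT_of_enoughInjectives M (n + 1) h

lemma aux_ses (R : Type u) [CommRing R] {X Y Z : Type u} [AddCommGroup X] [AddCommGroup Y]
    [AddCommGroup Z] [Module R X] [Module R Y] [Module R Z] (f : X →ₗ[R] Y) (g : Y →ₗ[R] Z)
    (hf : Function.Injective f) (hg : Function.Surjective g) (hfg : Function.Exact f g) :
    (ShortComplex.mk (ModuleCat.ofHom f) (ModuleCat.ofHom g)
      (by ext x; exact hfg.apply_apply_eq_zero x)).ShortExact where
  exact := (ShortComplex.ShortExact.moduleCat_exact_iff_function_exact _).mpr hfg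
  mono_f := (ModuleCat.mono_iff_injective _).mpr hf
  epi_g := (ModuleCat.epi_iff_surjective _).mpr hg

lemma aux_mid {R : Type u} [CommRing R] (M : ModuleCat.{u} R)
    {X Y Z : Type u} [AddCommGroup X] [AddCommGroup Y]
    [AddCommGroup Z] [Module R X] [Module R Y] [Module R Z] (f : X →ₗ[R] Y) (g : Y →ₗ[R] Z)
    (hf : Function.Injective f) (hg : Function.Surjective g) (hfg : Function.Exact f g) (k : ℕ)
    (hX : Subsingleton (Abelian.Ext.{u} M (ModuleCat.of R X) k))
    (hZ : Subsingleton (Abelian.Ext.{u} M (ModuleCat.of R Z) k)) :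
    Subsingleton (Abelian.Ext.{u} M (ModuleCat.of R Y) k) := by
  refine subsingleton_of_forall_eq 0 fun α ↦ ?_
  obtain ⟨x, hx⟩ := Abelian.Ext.covariant_sequence_exact₂ M (aux_ses R f g hf hg hfg) α
    (Subsingleton.elim (α := Abelian.Ext.{u} M (ModuleCat.of R Z) k) _ _)
  rw [← hx, Subsingleton.elim (α := Abelian.Ext.{u} M (ModuleCat.of R X) k) x 0]
  simp

lemma aux_right {R : Type u} [CommRing R] (M : ModuleCat.{u} R)
    {X Y Z : Type u} [AddCommGroup X] [AddCommGroup Y]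
    [AddCommGroup Z] [Module R X] [Module R Y] [Module R Z] (f : X →ₗ[R] Y) (g : Y →ₗ[R] Z)
    (hf : Function.Injective f) (hg : Function.Surjective g) (hfg : Function.Exact f g) (k : ℕ)
    (hX : Subsingleton (Abelian.Ext.{u} M (ModuleCat.of R X) (k + 1)))
    (hY : Subsingleton (Abelian.Ext.{u} M (ModuleCat.of R Y) k)) :
    Subsingleton (Abelian.Ext.{u} M (ModuleCat.of R Z) k) := by
  refine subsingleton_of_forall_eq 0 fun α ↦ ?_
  obtain ⟨x, hx⟩ := Abelian.Ext.covariant_sequence_exact₃ M (aux_ses R f g hf hg hfg) α rfl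
    (Subsingleton.elim (α := Abelian.Ext.{u} M (ModuleCat.of R X) (k + 1)) _ _)
  rw [← hx, Subsingleton.elim (α := Abelian.Ext.{u} M (ModuleCat.of R Y) k) x 0]
  simp

lemma aux_flat_ker {R : Type u} [CommRing R] 
    {X Y Z : Type u} [AddCommGroup X] [AddCommGroup Y]
    [AddCommGroup Z] [Module R X] [Module R Y] [Module R Z] (f : X →ₗ[R] Y) (g : Y →ₗ[R] Z)
    (hf : Function.Injective f) (hg : Function.Surjective g) (hfg : Function.Exact f g)
    [Module.Flat R Y] [Module.Flat R Z] : Module.Flat R X := by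
  rw [Module.Flat.iff_lTensor_preserves_injective_linearMap]
  intro N N' _ _ _ _ i hi
  have h1 : Function.Injective (f.rTensor N) :=
    (f.lTensor_inj_iff_rTensor_inj N).1 (LinearMap.lTensor_injective_of_exact_of_flat g hg f hf hfg N)
  have h2 := (Module.Flat.lTensor_preserves_injective_linearMap (M := Y) i hi).comp h1
  refine Function.Injective.of_comp (f := f.rTensor N') ?_
  rw [← LinearMap.coe_comp] at h2 ⊢
  rwa [LinearMap.rTensor_comp_lTensor, ← LinearMap.lTensor_comp_rTensor]

section Change

variable {A : Type u} (S : Type u) [CommRing A] [CommRing S] [Algebra A S]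
  {K F M : Type u} [AddCommGroup K] [AddCommGroup F] [AddCommGroup M]
  [Module A K] [Module A F] [Module A M] (f : K →ₗ[A] F) (g : F →ₗ[A] M)

lemma aux_bc (hf : Function.Injective f) (hg : Function.Surjective g) (hfg : Function.Exact f g)
    [Module.Flat A M] :
    Function.Injective (f.baseChange S) ∧ Function.Surjective (g.baseChange S) ∧
      Function.Exact (f.baseChange S) (g.baseChange S) := by
  refine ⟨?_, ?_, ?_⟩
  · have := LinearMap.lTensor_injective_of_exact_of_flat g hg f hf hfg S
    exact this
  · have := LinearMap.lTensor_surjective S hg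
    exact this
  · have := lTensor_exact S hfg hg
    exact this

lemma aux_base (hf : Function.Injective f) (hg : Function.Surjective g)
    (hfg : Function.Exact f g) [Module.Flat A M] [Module.Projective A F]
    (hM : Module.Projective S (S ⊗[A] M))
    (N : Type u) [AddCommGroup N] [Module A N] [Module S N] [IsScalarTower A S N] :
    Subsingleton (Abelian.Ext.{u} (ModuleCat.of A M) (ModuleCat.of A N) 1) := by
  obtain ⟨hfS, hgS, hfgS⟩ := aux_bc S f g hf hg hfg
  obtain ⟨s, hs⟩ := Module.projective_lifting_property (g.baseChange S) LinearMap.id hgS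
  have hsplit : (Function.Injective (f.baseChange S) ∧ ∃ l, g.baseChange S ∘ₗ l = LinearMap.id) ↔
      (Function.Surjective (g.baseChange S) ∧ ∃ l, l ∘ₗ f.baseChange S = LinearMap.id) :=
    (Function.Exact.split_tfae' hfgS).out 0 1
  obtain ⟨r, hr⟩ := (hsplit.1 ⟨hfS, s, hs⟩).2
  refine subsingleton_of_forall_eq 0 fun α ↦ ?_
  have hp : Projective (ModuleCat.of A F) := inferInstance
  let T := aux_ses A f g hf hg hfg
  obtain ⟨x, rfl⟩ := Abelian.Ext.contravariant_sequence_exact₃ T _ α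
    (Abelian.Ext.eq_zero_of_projective (P := ModuleCat.of A F) _) (n₀ := 0) rfl
  obtain ⟨x, rfl⟩ := (Abelian.Ext.mk₀_bijective _ _).2 x
  let x' : K →ₗ[A] N := x.hom
  let y := x'.liftBaseChange S
  let z : F →ₗ[A] N := ((y ∘ₗ r).restrictScalars A) ∘ₗ TensorProduct.mk A S _ 1
  have hz : z ∘ₗ f = x' := by
    ext t
    have := LinearMap.congr_fun hr (1 ⊗ₜ t)
    simp only [LinearMap.comp_apply, LinearMap.baseChange_tmul, LinearMap.id_apply] at this
    simp [z, y, this]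
  have hx : x = ModuleCat.ofHom f ≫ ModuleCat.ofHom z := by
    ext t
    exact (LinearMap.congr_fun hz t).symm
  rw [hx]
  change T.extClass.comp (Abelian.Ext.mk₀ (ModuleCat.ofHom f ≫ ModuleCat.ofHom z)) rfl = 0
  rw [← Abelian.Ext.mk₀_comp_mk₀]
  exact (T.extClass_comp_assoc _)

lemma aux_step (hf : Function.Injective f) (hg : Function.Surjective g)
    (hfg : Function.Exact f g) [Module.Flat A M] [Module.Projective A F] (k : ℕ)
    (N : Type u) [AddCommGroup N] [Module A N]
    (h : HasProjectiveDimensionLT (ModuleCat.of S (S ⊗[A] K)) (k + 1) →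
      Subsingleton (Abelian.Ext.{u} (ModuleCat.of A K) (ModuleCat.of A N) (k + 1)))
    (hM : HasProjectiveDimensionLT (ModuleCat.of S (S ⊗[A] M)) (k + 2)) :
    Subsingleton (Abelian.Ext.{u} (ModuleCat.of A M) (ModuleCat.of A N) (k + 2)) := by
  obtain ⟨hfS, hgS, hfgS⟩ := aux_bc S f g hf hg hfg
  have hp : Projective (ModuleCat.of A F) := inferInstance
  have hpS : Projective (ModuleCat.of S (S ⊗[A] F)) := inferInstance
  have := h (((aux_ses S _ _ hfS hgS hfgS).hasProjectiveDimensionLT_X₃_iff k hpS).1 hM)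
  refine subsingleton_of_forall_eq 0 fun α ↦ ?_
  obtain ⟨x, rfl⟩ := Abelian.Ext.contravariant_sequence_exact₃ (aux_ses A f g hf hg hfg) _ α
    (Abelian.Ext.eq_zero_of_projective (P := ModuleCat.of A F) _) (n₀ := k + 1) (by omega)
  rw [Subsingleton.elim
    (α := Abelian.Ext.{u} (ModuleCat.of A K) (ModuleCat.of A N) (k + 1)) x 0]
  simp

end Change

lemma aux_ker {A : Type u} [CommRing A] {F M : Type u} [AddCommGroup F] [AddCommGroup M]
    [Module A F] [Module A M] (g : F →ₗ[A] M) :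
    ∃ (K : Type u) (_ : AddCommGroup K) (_ : Module A K) (f : K →ₗ[A] F),
      Function.Injective f ∧ Function.Exact f g :=
  ⟨LinearMap.ker g, inferInstance, inferInstance, (LinearMap.ker g).subtype,
    Subtype.val_injective, LinearMap.exact_subtype_ker_map g⟩

lemma aux_change (A S : Type u) [CommRing A] [CommRing S] [Algebra A S] (k : ℕ) :
    ∀ (M : Type u) [AddCommGroup M] [Module A M] [Module.Flat A M]
      (_ : HasProjectiveDimensionLT (ModuleCat.of S (S ⊗[A] M)) (k + 1))
      (N : Type u) [AddCommGroup N] [Module A N] [Module S N] [IsScalarTower A S N],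
      Subsingleton (Abelian.Ext.{u} (ModuleCat.of A M) (ModuleCat.of A N) (k + 1)) := by
  induction k with
  | zero =>
    intro M _ _ _ hM N _ _ _ _
    rw [zero_add, ← projective_iff_hasProjectiveDimensionLT_one,
      ← IsProjective.iff_projective] at hM
    have hg := Finsupp.linearCombination_id_surjective A M
    obtain ⟨K, _, _, f, hf, hfg⟩ := aux_ker (Finsupp.linearCombination A (id : M → M))
    exact aux_base S f _ hf hg hfg hM N
  | succ k ih =>
    intro M _ _ _ hM N _ _ _ _
    have hg := Finsupp.linearCombination_id_surjective A M
    obtain ⟨K, _, _, f, hf, hfg⟩ := aux_ker (Finsupp.linearCombination A (id : M → M))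
    have hflat : Module.Flat A K := aux_flat_ker f _ hf hg hfg
    exact aux_step S f _ hf hg hfg k N (fun h ↦ ih K h N) hM

lemma aux_tors {A : Type u} [CommRing A] (Q : Ideal A) (M : ModuleCat.{u} A) (k : ℕ)
    (hQ : ∀ (N : Type u) [AddCommGroup N] [Module A N] [Module (A ⧸ Q) N]
      [IsScalarTower A (A ⧸ Q) N],
      Subsingleton (Abelian.Ext.{u} M (ModuleCat.of A N) k))
    (N : Type u) [AddCommGroup N] [Module A N] (h : ∀ q ∈ Q, ∀ x : N, q • x = 0) :
    Subsingleton (Abelian.Ext.{u} M (ModuleCat.of A N) k) := by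
  have t : Module.IsTorsionBySet A N (Q : Set A) := fun x q ↦ h q.1 q.2 x
  letI := t.module
  haveI : IsScalarTower A (A ⧸ Q) N := t.isScalarTower
  exact hQ N

lemma aux_main (A B : Type u) [CommRing A] [CommRing B] [Algebra A B]
    (hinj : Function.Injective (algebraMap A B))
    (Q : Ideal A)
    (hQB : (Q.map (algebraMap A B) : Set B) = algebraMap A B '' Q)
    (M : ModuleCat.{u} A) (k : ℕ)
    (hB : ∀ (N : Type u) [AddCommGroup N] [Module A N] [Module B N] [IsScalarTower A B N],
      Subsingleton (Abelian.Ext.{u} M (ModuleCat.of A N) k))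
    (hQ : ∀ (N : Type u) [AddCommGroup N] [Module A N] [Module (A ⧸ Q) N]
      [IsScalarTower A (A ⧸ Q) N],
      Subsingleton (Abelian.Ext.{u} M (ModuleCat.of A N) k))
    (hQ' : ∀ (N : Type u) [AddCommGroup N] [Module A N] [Module (A ⧸ Q) N]
      [IsScalarTower A (A ⧸ Q) N],
      Subsingleton (Abelian.Ext.{u} M (ModuleCat.of A N) (k + 1)))
    (N : Type u) [AddCommGroup N] [Module A N] :
    Subsingleton (Abelian.Ext.{u} M (ModuleCat.of A N) k) := by
  let J : Ideal B := Q.map (algebraMap A B)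
  have hJ : ∀ j : J, ∃ a ∈ Q, algebraMap A B a = j := fun j ↦ by
    have : (j : B) ∈ (J : Set B) := j.2
    rw [hQB] at this
    exact this
  choose e₀ he₀Q he₀ using hJ
  let e : J →ₗ[A] A :=
    { toFun := e₀
      map_add' := fun x y ↦ hinj (by simp [he₀])
      map_smul' := fun a x ↦ hinj (by simp [he₀, Algebra.smul_def]) }
  have he : ∀ j, algebraMap A B (e j) = j := he₀
  have heQ : ∀ q ∈ Q, ∃ j : J, e j = q := fun q hq ↦
    ⟨⟨algebraMap A B q, Ideal.mem_map_of_mem _ hq⟩, hinj (by rw [he])⟩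
  let φ : J ⊗[A] N →ₗ[A] N := TensorProduct.lift ((LinearMap.lsmul A N).comp e)
  have hφ : ∀ j n, φ (j ⊗ₜ n) = e j • n := fun j n ↦ by simp [φ]
  have key : ∀ (j₀ : J) (x : J ⊗[A] N), e j₀ • x = j₀ ⊗ₜ[A] φ x := by
    intro j₀ x
    induction x with
    | zero => simp
    | add x y hx hy => rw [smul_add, hx, hy, map_add, TensorProduct.tmul_add]
    | tmul j n =>
      have h : e j₀ • j = e j • j₀ := by
        ext
        simp [Algebra.smul_def, he, mul_comm]
      rw [hφ, TensorProduct.smul_tmul', h, TensorProduct.smul_tmul]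
  obtain ⟨K, _, _, f, hf, hfφ⟩ := aux_ker φ
  have t1 : ∀ q ∈ Q, ∀ x : K, q • x = 0 := by
    intro q hq x
    obtain ⟨j, rfl⟩ := heQ q hq
    apply hf
    rw [map_smul, key, hfφ.apply_apply_eq_zero, TensorProduct.tmul_zero, map_zero]
  have t2 : ∀ q ∈ Q, ∀ x : N ⧸ LinearMap.range φ, q • x = 0 := by
    rintro q hq x
    obtain ⟨j, rfl⟩ := heQ q hq
    obtain ⟨n, rfl⟩ := Submodule.mkQ_surjective _ x
    change e j • (LinearMap.range φ).mkQ n = 0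
    rw [← map_smul, Submodule.mkQ_apply, Submodule.Quotient.mk_eq_zero]
    exact ⟨j ⊗ₜ n, hφ j n⟩
  have h1 : Subsingleton (Abelian.Ext.{u} M (ModuleCat.of A (LinearMap.range φ)) k) :=
    aux_right M f φ.rangeRestrict hf φ.surjective_rangeRestrict
      (by rw [LinearMap.exact_iff, LinearMap.ker_rangeRestrict]; exact LinearMap.exact_iff.1 hfφ)
      k (aux_tors Q M _ hQ' K t1) (hB _)
  exact aux_mid M (LinearMap.range φ).subtype (LinearMap.range φ).mkQ Subtype.val_injective
    (Submodule.mkQ_surjective _) (LinearMap.exact_subtype_mkQ _) k h1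
    (aux_tors Q M _ hQ _ t2)

lemma aux_vanish (A S : Type u) [CommRing A] [CommRing S] [Algebra A S] (n : ℕ)
    (hS : IsNPerfect S n) (M : Type u) [AddCommGroup M] [Module A M] [Module.Flat A M]
    (k : ℕ) (hk : n ≤ k)
    (N : Type u) [AddCommGroup N] [Module A N] [Module S N] [IsScalarTower A S N] :
    Subsingleton (Abelian.Ext.{u} (ModuleCat.of A M) (ModuleCat.of A N) (k + 1)) := by
  have h : HasProjectiveDimensionLT (ModuleCat.of S (S ⊗[A] M)) (n + 1) :=
    aux_pd S _ n fun N ↦ (aux_bridge S _ N n).1 (hS (S ⊗[A] M) inferInstance N)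
  exact aux_change A S k M (hasProjectiveDimensionLT_of_ge _ (n + 1) (k + 1) (by omega)) N

end Helpers

theorem nPerfect_of_pullback
    (A B : Type u) [CommRing A] [CommRing B] [Algebra A B]
    (hinj : Function.Injective (algebraMap A B)) [Module.Flat A B]
    (Q : Ideal A)
    (hQB : (Q.map (algebraMap A B) : Set B) = algebraMap A B '' Q)
    (n : ℕ) (hB : IsNPerfect B n) (hAQ : IsNPerfect (A ⧸ Q) n) :
    IsNPerfect A n := by
  intro M _ _ _ N
  rw [aux_bridge]
  exact aux_main A B hinj Q hQB (ModuleCat.of A M) (n + 1)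
    (fun N _ _ _ _ ↦ aux_vanish A B n hB M n le_rfl N)
    (fun N _ _ _ _ ↦ aux_vanish A (A ⧸ Q) n hAQ M n le_rfl N)
    (fun N _ _ _ _ ↦ aux_vanish A (A ⧸ Q) n hAQ M (n + 1) (Nat.le_succ n) N) N
end
end

section
/- Let A → B be a ring homomorphism making B a faithfully flat A-module. If B is a strong n-perfect ring, then A is a strong n-perfect ring. -/
open CategoryTheory CategoryTheory.Limits

noncomputable section

universe u

namespace SNP
open TensorProduct

/-- Solvability of a linear factorization problem descends along faithfully flat maps. -/
lemma descend_factor {A B : Type*} [CommRing A] [CommRing B] [Algebra A B]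
    [Module.FaithfullyFlat A B] {E F G : Type*} [AddCommGroup E] [AddCommGroup F]
    [AddCommGroup G] [Module A E] [Module A F] [Module A G] [Module.FinitePresentation A E]
    [Module.FinitePresentation A G]
    (v : E →ₗ[A] F) (v' : E →ₗ[A] G)
    (τ : (B ⊗[A] G) →ₗ[B] (B ⊗[A] F))
    (h : v.baseChange B = τ ∘ₗ v'.baseChange B) :
    ∃ t : G →ₗ[A] F, v = t ∘ₗ v' := by
  have b1 := Module.FinitePresentation.isBaseChange_map A G F B
  have b2 := Module.FinitePresentation.isBaseChange_map A E F B
  let L : (G →ₗ[A] F) →ₗ[A] (E →ₗ[A] F) :=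
    LinearMap.lcomp A _ v'
  suffices hv : v ∈ LinearMap.range L by
    obtain ⟨t, ht⟩ := hv
    exact ⟨t, ht.symm⟩
  refine (Submodule.Quotient.mk_eq_zero _).1 ?_
  refine (Module.FaithfullyFlat.one_tmul_eq_zero_iff A _ (A := B) _).1 ?_
  obtain ⟨y, rfl⟩ := b1.equiv.surjective τ
  have key : ∀ y, b2.equiv (L.baseChange B y) = b1.equiv y ∘ₗ v'.baseChange B := by
    intro y
    induction y with
    | zero => simp
    | add x y hx hy => simp only [map_add, hx, hy, LinearMap.add_comp]
    | tmul b t =>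
      simp only [LinearMap.baseChange_tmul, IsBaseChange.equiv_tmul, LinearMap.smul_comp]
      congr 1
      exact LinearMap.baseChange_comp _ _
  have e : (1 : B) ⊗ₜ[A] v = L.baseChange B y := by
    apply b2.equiv.injective
    rw [key, ← h]
    simp
  have : (1 : B) ⊗ₜ[A] (Submodule.Quotient.mk v : _ ⧸ LinearMap.range L) =
      (LinearMap.range L).mkQ.baseChange B (1 ⊗ₜ v) := by simp
  rw [this, e, ← LinearMap.comp_apply, ← LinearMap.baseChange_comp, LinearMap.range_mkQ_comp]
  simp

set_option maxHeartbeats 1000000 in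
/-- The Mittag-Leffler type property of a flat module that becomes projective after a
faithfully flat base change. -/
lemma exists_dominating {A B : Type*} [CommRing A] [CommRing B] [Algebra A B]
    [Module.FaithfullyFlat A B] {Q : Type*} [AddCommGroup Q] [Module A Q] [Module.Flat A Q]
    [hP : Module.Projective B (B ⊗[A] Q)] {E : Type*} [AddCommGroup E] [Module A E] [Module.Free A E]
    [Module.Finite A E] (u : E →ₗ[A] Q) :
    ∃ (m : ℕ) (v : E →ₗ[A] (Fin m →₀ A)) (w : (Fin m →₀ A) →ₗ[A] Q),
      u = w ∘ₗ v ∧ ∀ (m' : ℕ) (v' : E →ₗ[A] (Fin m' →₀ A))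
        (w' : (Fin m' →₀ A) →ₗ[A] Q), u = w' ∘ₗ v' → ∃ t, v = t ∘ₗ v' := by
  classical
  let e := Module.Free.chooseBasis A E
  obtain ⟨s, hs⟩ := Module.projective_def'.1 hP
  let J : Set (B ⊗[A] Q) := ⋃ i : Module.Free.ChooseBasisIndex A E,
    ((s (u.baseChange B (1 ⊗ₜ e i))).support : Set (B ⊗[A] Q))
  have hJ : J.Finite := Set.finite_iUnion fun i => Finset.finite_toSet _
  obtain ⟨N', hN', hJN⟩ := exists_finite_submodule_right_of_setFinite J hJ
  obtain ⟨r, π, hπ⟩ := Module.Finite.exists_fin' A N'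
  let u1 : (E × (Fin r → A)) →ₗ[A] Q := u.coprod (N'.subtype ∘ₗ π)
  have hu1 : u1 ∘ₗ LinearMap.inl A _ _ = u := LinearMap.coprod_inl _ _
  have hJr : ∀ j ∈ J, ∃ y, u1.baseChange B y = j := by
    intro j hj
    obtain ⟨y, rfl⟩ := hJN hj
    obtain ⟨z, rfl⟩ := LinearMap.lTensor_surjective B hπ y
    refine ⟨(LinearMap.inr A E (Fin r → A)).baseChange B z, ?_⟩
    rw [← LinearMap.comp_apply, ← LinearMap.baseChange_comp, LinearMap.coprod_inr,
      LinearMap.baseChange_comp]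
    rfl
  let g0 : (B ⊗[A] Q) → B ⊗[A] (E × (Fin r → A)) := fun j =>
    if h : ∃ y, u1.baseChange B y = j then h.choose else 0
  have hg0 : ∀ j ∈ J, u1.baseChange B (g0 j) = j := by
    intro j hj
    have h := hJr j hj
    simp only [g0, dif_pos h]
    exact h.choose_spec
  let g1 : ((B ⊗[A] Q) →₀ B) →ₗ[B] B ⊗[A] (E × (Fin r → A)) :=
    Finsupp.linearCombination B g0
  let z : Module.Free.ChooseBasisIndex A E → B ⊗[A] (E × (Fin r → A)) := fun i =>
    g1 (s (u.baseChange B (1 ⊗ₜ e i))) -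
      (LinearMap.inl A _ _).baseChange B (1 ⊗ₜ e i)
  have hz : ∀ i, u1.baseChange B (z i) = 0 := by
    intro i
    have h1 : u1.baseChange B (g1 (s (u.baseChange B (1 ⊗ₜ e i)))) =
        u.baseChange B (1 ⊗ₜ e i) := by
      conv_rhs => rw [← LinearMap.id_apply (R := B) (u.baseChange B _), ← hs]
      simp only [g1, LinearMap.comp_apply, Finsupp.linearCombination_apply, Finsupp.sum, map_sum,
        map_smul]
      refine Finset.sum_congr rfl fun j hj => ?_
      rw [hg0 j (Set.mem_iUnion.2 ⟨i, hj⟩), id]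
    simp only [z, map_sub, h1]
    rw [← LinearMap.comp_apply, ← LinearMap.baseChange_comp, hu1, sub_self]
  -- the `z i` come from the kernel
  have hex : Function.Exact ((LinearMap.ker u1).subtype.lTensor B) (u1.lTensor B) :=
    Module.Flat.lTensor_exact B (LinearMap.exact_subtype_ker_map u1)
  choose y hy using fun i => (hex (z i)).1 (hz i)
  obtain ⟨K, hK, hyK⟩ := exists_finite_submodule_right_of_setFinite (Set.range y)
    (Set.finite_range y)
  have hzero : u1 ∘ₗ ((LinearMap.ker u1).subtype ∘ₗ K.subtype) = 0 := by
    ext x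
    exact x.1.2
  obtain ⟨m, a, w, hwa, ha⟩ := Module.Flat.exists_factorization_of_comp_eq_zero_of_free
    (K := K) (N := E × (Fin r → A)) (x := u1) hzero
  have haz : ∀ i, a.baseChange B (z i) = 0 := by
    intro i
    obtain ⟨x, hx⟩ := hyK ⟨i, rfl⟩
    rw [← hy, ← hx]
    have := congrArg (fun f => f.lTensor B x) ha
    simp only [LinearMap.lTensor_comp, LinearMap.lTensor_zero, LinearMap.comp_apply] at this
    exact this
  refine ⟨m, a ∘ₗ LinearMap.inl A _ _, w, ?_, ?_⟩
  · rw [← LinearMap.comp_assoc, ← hwa, hu1]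
  · intro m' v' w' hu
    have hv : (a ∘ₗ LinearMap.inl A _ _).baseChange B =
        (a.baseChange B ∘ₗ g1 ∘ₗ s ∘ₗ w'.baseChange B) ∘ₗ v'.baseChange B := by
      have : (a.baseChange B ∘ₗ g1 ∘ₗ s ∘ₗ w'.baseChange B) ∘ₗ v'.baseChange B =
          a.baseChange B ∘ₗ g1 ∘ₗ s ∘ₗ u.baseChange B := by
        rw [hu, LinearMap.baseChange_comp]; rfl
      rw [this]
      apply TensorProduct.AlgebraTensorModule.curry_injective
      refine LinearMap.ext_ring (e.ext fun i => ?_)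
      · have := haz i
        simp only [z, map_sub, sub_eq_zero] at this
        simp only [AlgebraTensorModule.curry_apply,
          curry_apply, LinearMap.coe_restrictScalars, LinearMap.comp_apply,
          LinearMap.baseChange_comp]
        exact this.symm
    have := Module.finitePresentation_of_projective A E
    exact descend_factor _ _ _ hv

lemma dominating_step {A B : Type*} [CommRing A] [CommRing B] [Algebra A B]
    [Module.FaithfullyFlat A B] {Q : Type*} [AddCommGroup Q] [Module A Q] [Module.Flat A Q]
    [hP : Module.Projective B (B ⊗[A] Q)] {k : ℕ} (u : (Fin k →₀ A) →ₗ[A] Q) (q : Q) :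
    ∃ (m : ℕ) (v : (Fin k →₀ A) →ₗ[A] (Fin m →₀ A)) (w : (Fin m →₀ A) →ₗ[A] Q),
      u = w ∘ₗ v ∧ q ∈ LinearMap.range w ∧ ∀ (m' : ℕ) (v' : (Fin k →₀ A) →ₗ[A] (Fin m' →₀ A))
        (w' : (Fin m' →₀ A) →ₗ[A] Q), u = w' ∘ₗ v' → ∃ t, v = t ∘ₗ v' := by
  obtain ⟨m, v, w, huv, hdom⟩ := exists_dominating (B := B) u
  let e := ((Module.Free.chooseBasis A ((Fin m →₀ A) × A)).reindex (Fintype.equivFin _)).repr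
  refine ⟨_, e.toLinearMap ∘ₗ LinearMap.inl A _ _ ∘ₗ v,
    (w.coprod (LinearMap.toSpanSingleton A Q q)) ∘ₗ e.symm.toLinearMap, ?_, ?_, ?_⟩
  · rw [huv]
    ext
    simp
  · exact ⟨e (0, 1), by simp⟩
  · intro m' v' w' h
    obtain ⟨t, rfl⟩ := hdom m' v' w' h
    exact ⟨e.toLinearMap ∘ₗ LinearMap.inl A _ _ ∘ₗ t, rfl⟩

lemma exists_system {A B : Type*} [CommRing A] [CommRing B] [Algebra A B]
    [Module.FaithfullyFlat A B] {Q : Type*} [AddCommGroup Q] [Module A Q] [Module.Flat A Q]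
    [hP : Module.Projective B (B ⊗[A] Q)] (c : ℕ → Q) :
    ∃ (d : ℕ → ℕ) (U : ∀ k, (Fin (d k) →₀ A) →ₗ[A] Q)
      (V : ∀ k, (Fin (d k) →₀ A) →ₗ[A] (Fin (d (k + 1)) →₀ A))
      (T : ∀ k, (Fin (d (k + 2)) →₀ A) →ₗ[A] (Fin (d (k + 1)) →₀ A)),
      (∀ k, U k = U (k + 1) ∘ₗ V k) ∧ (∀ k, c k ∈ LinearMap.range (U (k + 1))) ∧
      (∀ k, V k = T k ∘ₗ V (k + 1) ∘ₗ V k) ∧ (∀ k x, U k x = 0 → V k x = 0) := by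
  choose M v w h1 h2 h3 using fun (k : ℕ) (u : (Fin k →₀ A) →ₗ[A] Q) (q : Q) =>
    dominating_step (B := B) u q
  let st : ℕ → Σ k : ℕ, ((Fin k →₀ A) →ₗ[A] Q) := fun n =>
    Nat.rec ⟨0, 0⟩ (fun i s => ⟨M s.1 s.2 (c i), w s.1 s.2 (c i)⟩) n
  let d : ℕ → ℕ := fun n => (st n).1
  let U : ∀ k, (Fin (d k) →₀ A) →ₗ[A] Q := fun k => (st k).2
  let V : ∀ k, (Fin (d k) →₀ A) →ₗ[A] (Fin (d (k + 1)) →₀ A) := fun k => v _ (st k).2 (c k)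
  have hU : ∀ k, U k = U (k + 1) ∘ₗ V k := fun k => h1 _ (st k).2 (c k)
  have hdom : ∀ k (m' : ℕ) (v' : (Fin (d k) →₀ A) →ₗ[A] (Fin m' →₀ A))
        (w' : (Fin m' →₀ A) →ₗ[A] Q), U k = w' ∘ₗ v' → ∃ t, V k = t ∘ₗ v' :=
    fun k => h3 _ (st k).2 (c k)
  choose T hT using fun k => hdom k _ (V (k + 1) ∘ₗ V k) (U (k + 2)) (by
    rw [← LinearMap.comp_assoc, ← hU (k + 1), ← hU k])
  refine ⟨d, U, V, T, hU, fun k => h2 _ (st k).2 (c k), hT, ?_⟩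
  intro k x hx
  obtain ⟨m, a, y, hay, hax⟩ := Module.Flat.exists_factorization_of_apply_eq_zero_of_free hx
  obtain ⟨t, ht⟩ := hdom k m a y hay
  rw [ht, LinearMap.comp_apply, hax, map_zero]

lemma section_of_system {A : Type*} [CommRing A] {Q : Type*} [AddCommGroup Q] [Module A Q]
    {N : Type*} [AddCommGroup N] [Module A N] (g : N →ₗ[A] Q) (hg : Function.Surjective g)
    (c : ℕ → Q) (hc : Submodule.span A (Set.range c) = ⊤)
    (d : ℕ → ℕ) (U : ∀ k, (Fin (d k) →₀ A) →ₗ[A] Q)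
    (V : ∀ k, (Fin (d k) →₀ A) →ₗ[A] (Fin (d (k + 1)) →₀ A))
    (T : ∀ k, (Fin (d (k + 2)) →₀ A) →ₗ[A] (Fin (d (k + 1)) →₀ A))
    (hU : ∀ k, U k = U (k + 1) ∘ₗ V k) (hcU : ∀ k, c k ∈ LinearMap.range (U (k + 1)))
    (hT : ∀ k, V k = T k ∘ₗ V (k + 1) ∘ₗ V k) (hV : ∀ k x, U k x = 0 → V k x = 0) :
    ∃ σ : Q →ₗ[A] N, g ∘ₗ σ = LinearMap.id := by
  have step : ∀ k (l : {l : (Fin (d (k + 1)) →₀ A) →ₗ[A] N // g ∘ₗ l = U (k + 1)}),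
      ∃ l' : {l : (Fin (d (k + 2)) →₀ A) →ₗ[A] N // g ∘ₗ l = U (k + 2)},
        l'.1 ∘ₗ V (k + 1) ∘ₗ V k = l.1 ∘ₗ V k := by
    rintro k ⟨l, hl⟩
    obtain ⟨l', hl'⟩ := Module.projective_lifting_property g (U (k + 2)) hg
    refine ⟨⟨l' + (l - l' ∘ₗ V (k + 1)) ∘ₗ T k, ?_⟩, ?_⟩
    · rw [LinearMap.comp_add, ← LinearMap.comp_assoc, LinearMap.comp_sub, hl,
        ← LinearMap.comp_assoc, hl', ← hU, sub_self, LinearMap.zero_comp, add_zero]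
    · ext1 i
      ext1
      have h := LinearMap.congr_fun (hT k) (Finsupp.single i 1)
      simp only [LinearMap.comp_apply] at h
      simp only [LinearMap.comp_apply, LinearMap.add_apply, LinearMap.sub_apply,
        Finsupp.lsingle_apply]
      rw [← h]
      abel
  obtain ⟨l0, hl0⟩ := Module.projective_lifting_property g (U 1) hg
  choose nx hnx using step
  let L : ∀ k, {l : (Fin (d (k + 1)) →₀ A) →ₗ[A] N // g ∘ₗ l = U (k + 1)} := fun k =>
    Nat.rec ⟨l0, hl0⟩ (fun k l => nx k l) k
  have hL : ∀ k, (L (k + 1)).1 ∘ₗ V (k + 1) ∘ₗ V k = (L k).1 ∘ₗ V k := fun k => hnx k (L k)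
  let m : ∀ k, (Fin (d k) →₀ A) →ₗ[A] N := fun k => (L k).1 ∘ₗ V k
  have hgm : ∀ k x, g (m k x) = U k x := by
    intro k x
    have := LinearMap.congr_fun (L k).2 (V k x)
    rw [hU k]
    exact this
  have hm : ∀ k x, m (k + 1) (V k x) = m k x := fun k x => LinearMap.congr_fun (hL k) x
  let G : ℕ → Submodule A (Q × N) := fun k => LinearMap.range ((U k).prod (m k))
  have hG : Monotone G := by
    refine monotone_nat_of_le_succ fun k => ?_
    rintro _ ⟨x, rfl⟩
    refine ⟨V k x, ?_⟩
    refine Prod.ext ?_ (hm k x)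
    change U (k + 1) (V k x) = U k x
    rw [hU k]
    rfl
  have hmem : ∀ p, p ∈ (⨆ k, G k) ↔ ∃ k, p ∈ G k := fun p =>
    Submodule.mem_iSup_of_directed _ hG.directed_le
  let φ : (⨆ k, G k : Submodule A _) →ₗ[A] Q := LinearMap.fst A _ _ ∘ₗ Submodule.subtype _
  have hinj : Function.Injective φ := by
    rw [← LinearMap.ker_eq_bot, LinearMap.ker_eq_bot']
    rintro ⟨p, hp⟩ h0
    obtain ⟨k, x, rfl⟩ := (hmem p).1 hp
    have hx : U k x = 0 := h0
    apply Subtype.ext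
    simp [m, hx, hV k x hx]
  have hsurj : Function.Surjective φ := by
    rw [← LinearMap.range_eq_top, eq_top_iff, ← hc, Submodule.span_le]
    rintro _ ⟨k, rfl⟩
    obtain ⟨x, hx⟩ := hcU k
    exact ⟨⟨_, (hmem _).2 ⟨k + 1, x, rfl⟩⟩, hx⟩
  let e := LinearEquiv.ofBijective φ ⟨hinj, hsurj⟩
  refine ⟨LinearMap.snd A Q N ∘ₗ Submodule.subtype _ ∘ₗ e.symm.toLinearMap, ?_⟩
  ext q
  obtain ⟨p, rfl⟩ := e.surjective q
  obtain ⟨k, x, hx⟩ := (hmem p.1).1 p.2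
  simp only [LinearMap.comp_apply, LinearEquiv.coe_coe, LinearEquiv.symm_apply_apply,
    LinearMap.id_apply]
  change g p.1.2 = p.1.1
  rw [← hx]
  exact hgm k x

lemma projective_of_countable {A B : Type*} [CommRing A] [CommRing B] [Algebra A B]
    [Module.FaithfullyFlat A B] {Q : Type*} [AddCommGroup Q] [Module A Q]
    [hP : Module.Projective B (B ⊗[A] Q)] (c : ℕ → Q)
    (hc : Submodule.span A (Set.range c) = ⊤) : Module.Projective A Q := by
  have : Module.Flat A Q := Module.Flat.of_flat_tensorProduct A Q B
  obtain ⟨d, U, V, T, h1, h2, h3, h4⟩ := exists_system (B := B) (A := A) c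
  obtain ⟨σ, hσ⟩ := section_of_system (Finsupp.linearCombination A (id : Q → Q))
    (Finsupp.linearCombination_id_surjective A Q) c hc d U V T h1 h2 h3 h4
  exact Module.Projective.of_split σ _ hσ

/-- Submodules compatible with a presentation of the base change as a summand of a free module. -/
def Adapted {A B M I : Type*} [CommRing A] [CommRing B] [Algebra A B] [AddCommGroup M] [Module A M]
    (s : B ⊗[A] M →ₗ[B] (I →₀ B)) (e : I → B ⊗[A] M) (N : Submodule A M) : Prop :=
  ∀ x ∈ N, ∀ i ∈ (s (1 ⊗ₜ x)).support, e i ∈ N.baseChange B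

lemma adapted_sSup {A B M I : Type*} [CommRing A] [CommRing B] [Algebra A B] [AddCommGroup M]
    [Module A M] (s : B ⊗[A] M →ₗ[B] (I →₀ B)) (e : I → B ⊗[A] M) (T : Set (Submodule A M))
    (hT : ∀ N ∈ T, Adapted s e N) : Adapted s e (sSup T) := by
  classical
  let S : Set I := {i | e i ∈ (sSup T).baseChange B}
  let W : Submodule A M := ((Finsupp.supported B B S).comap s |>.restrictScalars A).comap
    (TensorProduct.mk A B M 1)
  have hW : ∀ x, x ∈ W ↔ ∀ i ∈ (s (1 ⊗ₜ x)).support, e i ∈ (sSup T).baseChange B := by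
    intro x
    rfl
  have : sSup T ≤ W := by
    refine sSup_le fun N hN x hx => (hW x).2 fun i hi => ?_
    exact Submodule.baseChange_mono B (le_sSup hN) (hT N hN x hx i hi)
  intro x hx
  exact (hW x).1 (this hx)

lemma exists_finset_mem_baseChange {A B M : Type*} [CommRing A] [CommRing B] [Algebra A B]
    [AddCommGroup M] [Module A M] (z : B ⊗[A] M) :
    ∃ F : Finset M, z ∈ (Submodule.span A (F : Set M)).baseChange B := by
  classical
  induction z using TensorProduct.induction_on with
  | zero => exact ⟨∅, Submodule.zero_mem _⟩
  | tmul b x =>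
    exact ⟨{x}, Submodule.tmul_mem_baseChange_of_mem _ (Submodule.subset_span (by simp))⟩
  | add x y hx hy =>
    obtain ⟨F, hF⟩ := hx
    obtain ⟨G, hG⟩ := hy
    refine ⟨F ∪ G, Submodule.add_mem _ ?_ ?_⟩
    · exact Submodule.baseChange_mono B (Submodule.span_mono (by simp)) hF
    · exact Submodule.baseChange_mono B (Submodule.span_mono (by simp)) hG

lemma exists_adapted_countable {A B M I : Type*} [CommRing A] [CommRing B] [Algebra A B]
    [AddCommGroup M] [Module A M] (s : B ⊗[A] M →ₗ[B] (I →₀ B)) (e : I → B ⊗[A] M) (x : M) :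
    ∃ C : Set M, C.Countable ∧ x ∈ C ∧ Adapted s e (Submodule.span A C) := by
  classical
  choose F hF using fun i => exists_finset_mem_baseChange (A := A) (B := B) (e i)
  let φ : M → Set M := fun y => ⋃ i ∈ (s (1 ⊗ₜ y)).support, (F i : Set M)
  have hφ : ∀ y, (φ y).Countable := fun y =>
    Set.Countable.biUnion (Finset.countable_toSet _) fun i _ => Finset.countable_toSet _
  let C : ℕ → Set M := fun n => Nat.rec {x} (fun _ D => ⋃ y ∈ D, φ y) n
  have hC : ∀ n, (C n).Countable := by
    intro n
    induction n with
    | zero => exact Set.countable_singleton x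
    | succ n ih => exact Set.Countable.biUnion ih fun y _ => hφ y
  refine ⟨⋃ n, C n, Set.countable_iUnion hC, Set.mem_iUnion.2 ⟨0, rfl⟩, ?_⟩
  let S : Set I := {i | e i ∈ (Submodule.span A (⋃ n, C n)).baseChange B}
  let W : Submodule A M := ((Finsupp.supported B B S).comap s |>.restrictScalars A).comap
    (TensorProduct.mk A B M 1)
  have hW : ∀ x, x ∈ W ↔ ∀ i ∈ (s (1 ⊗ₜ x)).support,
      e i ∈ (Submodule.span A (⋃ n, C n)).baseChange B := by
    intro x
    rfl
  have : Submodule.span A (⋃ n, C n) ≤ W := by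
    refine Submodule.span_le.2 fun y hy => (hW y).2 fun i hi => ?_
    obtain ⟨n, hn⟩ := Set.mem_iUnion.1 hy
    refine Submodule.baseChange_mono B (Submodule.span_mono ?_) (hF i)
    intro z hz
    refine Set.mem_iUnion.2 ⟨n + 1, ?_⟩
    exact Set.mem_biUnion hn (Set.mem_biUnion (s := ((s (1 ⊗ₜ y)).support : Set I)) hi hz)
  intro y hy
  exact (hW y).1 (this hy)

lemma mkQ_baseChange_eq_zero {A B M : Type*} [CommRing A] [CommRing B] [Algebra A B]
    [Module.Flat A B] [AddCommGroup M] [Module A M] {N N' : Submodule A M} (h : N ≤ N')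
    (z : B ⊗[A] N') (hz : N'.subtype.baseChange B z ∈ N.baseChange B) :
    (N.submoduleOf N').mkQ.baseChange B z = 0 := by
  have hinj : Function.Injective (N'.subtype.baseChange B) :=
    Module.Flat.lTensor_preserves_injective_linearMap _ N'.injective_subtype
  obtain ⟨w, hw⟩ : ∃ w : B ⊗[A] N, N.subtype.baseChange B w = N'.subtype.baseChange B z := by
    have : N.baseChange B ≤ LinearMap.range (N.subtype.baseChange B) := by
      rw [Submodule.baseChange_eq_span, Submodule.span_le]
      rintro _ ⟨x, hx, rfl⟩
      exact ⟨1 ⊗ₜ ⟨x, hx⟩, by simp⟩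
    exact this hz
  have hz' : z = (Submodule.inclusion h).baseChange B w := by
    apply hinj
    rw [← hw, ← LinearMap.comp_apply, ← LinearMap.baseChange_comp]
    rfl
  rw [hz', ← LinearMap.comp_apply, ← LinearMap.baseChange_comp]
  have : (N.submoduleOf N').mkQ ∘ₗ Submodule.inclusion h = 0 := by
    refine LinearMap.ext fun x => ?_
    exact (Submodule.Quotient.mk_eq_zero _).2 x.2
  rw [this]
  simp

lemma projective_baseChange_quotient {A B M I : Type*} [CommRing A] [CommRing B] [Algebra A B]
    [Module.Flat A B] [AddCommGroup M] [Module A M]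
    (s : B ⊗[A] M →ₗ[B] (I →₀ B)) (e : I → B ⊗[A] M)
    (hs : ∀ z, Finsupp.linearCombination B e (s z) = z)
    {N N' : Submodule A M} (h : N ≤ N') (hN : Adapted s e N) (hN' : Adapted s e N') :
    Module.Projective B (B ⊗[A] (N' ⧸ N.submoduleOf N')) := by
  classical
  have hinj : Function.Injective (N'.subtype.baseChange B) :=
    Module.Flat.lTensor_preserves_injective_linearMap _ N'.injective_subtype
  have hex : ∀ i, ∃ w : B ⊗[A] N', e i ∈ N'.baseChange B → N'.subtype.baseChange B w = e i := by
    intro i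
    by_cases hi : e i ∈ N'.baseChange B
    · have : N'.baseChange B ≤ LinearMap.range (N'.subtype.baseChange B) := by
        rw [Submodule.baseChange_eq_span, Submodule.span_le]
        rintro _ ⟨x, hx, rfl⟩
        exact ⟨1 ⊗ₜ ⟨x, hx⟩, by simp⟩
      obtain ⟨w, hw⟩ := this hi
      exact ⟨w, fun _ => hw⟩
    · exact ⟨0, fun h => absurd h hi⟩
  choose P hP using hex
  set q := (N.submoduleOf N').mkQ.baseChange B with hq
  let S : Set I := {i | e i ∈ N.baseChange B}
  let ρ : (I →₀ B) →ₗ[B] (I →₀ B) :=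
    Finsupp.linearCombination B (fun i => if i ∈ S then 0 else Finsupp.single i 1)
  let pb : (I →₀ B) →ₗ[B] B ⊗[A] (N' ⧸ N.submoduleOf N') :=
    Finsupp.linearCombination B (fun i => q (P i))
  have hqP : ∀ i ∈ S, q (P i) = 0 := by
    intro i hi
    apply mkQ_baseChange_eq_zero h
    rw [hP i (Submodule.baseChange_mono B h hi)]
    exact hi
  have hρ : pb ∘ₗ ρ = pb := by
    refine Finsupp.lhom_ext' fun i => LinearMap.ext_ring ?_
    by_cases hi : i ∈ S
    · simp [pb, ρ, hi, hqP i hi]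
    · simp [pb, ρ, hi]
  have hρ0 : ∀ f : I →₀ B, (∀ i ∈ f.support, i ∈ S) → ρ f = 0 := by
    intro f hf
    simp only [ρ, Finsupp.linearCombination_apply, Finsupp.sum]
    exact Finset.sum_eq_zero fun i hi => by simp [hf i hi]
  let t0 : N' →ₗ[A] (I →₀ B) :=
    ((ρ ∘ₗ s).restrictScalars A) ∘ₗ (TensorProduct.mk A B M 1) ∘ₗ N'.subtype
  have ht0 : N.submoduleOf N' ≤ LinearMap.ker t0 := by
    intro y hy
    exact hρ0 _ (hN _ hy)
  let sb : B ⊗[A] (N' ⧸ N.submoduleOf N') →ₗ[B] (I →₀ B) :=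
    ((N.submoduleOf N').liftQ t0 ht0).liftBaseChange B
  refine Module.Projective.of_split sb pb ?_
  refine TensorProduct.AlgebraTensorModule.ext fun b y => ?_
  obtain ⟨y, rfl⟩ := Submodule.mkQ_surjective _ y
  have h1 : sb (b ⊗ₜ (N.submoduleOf N').mkQ y) = b • ρ (s (1 ⊗ₜ (y : M))) := by
    simp [sb, t0]
  have h2 : Finsupp.linearCombination B P (s (1 ⊗ₜ (y : M))) = 1 ⊗ₜ y := by
    apply hinj
    rw [LinearMap.baseChange_tmul]
    conv_rhs => rw [Submodule.subtype_apply, ← hs (1 ⊗ₜ (y : M))]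
    simp only [Finsupp.linearCombination_apply, Finsupp.sum, map_sum, map_smul]
    refine Finset.sum_congr rfl fun i hi => ?_
    rw [hP i (hN' _ y.2 i hi)]
  have h3 : pb (s (1 ⊗ₜ (y : M))) = q (1 ⊗ₜ y) := by
    rw [← h2]
    simp only [pb, Finsupp.linearCombination_apply, Finsupp.sum, map_sum, map_smul]
  rw [LinearMap.comp_apply, h1, map_smul, ← LinearMap.comp_apply, hρ, h3, ← map_smul]
  simp [hq, TensorProduct.smul_tmul']

lemma exists_complement {A M : Type*} [CommRing A] [AddCommGroup M] [Module A M]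
    {N N' : Submodule A M} (h : N ≤ N') [Module.Projective A (N' ⧸ N.submoduleOf N')] :
    ∃ C : Submodule A M, Module.Projective A C ∧ Disjoint N C ∧ N ⊔ C = N' := by
  obtain ⟨g, hg⟩ := Module.projective_lifting_property (N.submoduleOf N').mkQ LinearMap.id
    (Submodule.mkQ_surjective _)
  have hg' : ∀ y, (N.submoduleOf N').mkQ (g y) = y := fun y => LinearMap.congr_fun hg y
  have hmem : ∀ y : N', (N.submoduleOf N').mkQ y = 0 ↔ (y : M) ∈ N := fun y =>
    Submodule.Quotient.mk_eq_zero _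
  have hginj : Function.Injective (N'.subtype ∘ₗ g) :=
    N'.injective_subtype.comp (Function.LeftInverse.injective hg')
  refine ⟨LinearMap.range (N'.subtype ∘ₗ g), ?_, ?_, ?_⟩
  · exact Module.Projective.of_equiv (LinearEquiv.ofInjective _ hginj)
  · rw [Submodule.disjoint_def]
    rintro _ hx ⟨y, rfl⟩
    have : (N.submoduleOf N').mkQ (g y) = 0 := (hmem _).2 hx
    rw [hg'] at this
    simp [this]
  · apply le_antisymm
    · refine sup_le h ?_
      rintro _ ⟨y, rfl⟩
      exact (g y).2
    · intro x hx
      let y := (N.submoduleOf N').mkQ ⟨x, hx⟩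
      have : (N.submoduleOf N').mkQ (⟨x, hx⟩ - g y) = 0 := by
        rw [map_sub, hg']
        exact sub_self _
      have h2 := (hmem _).1 this
      have : x = (x - (g y : M)) + (N'.subtype ∘ₗ g) y := by simp
      rw [this]
      exact Submodule.add_mem_sup h2 ⟨y, rfl⟩

lemma sSupIndep_insert {A M : Type*} [CommRing A] [AddCommGroup M] [Module A M]
    {T : Set (Submodule A M)} (hT : sSupIndep T) {C : Submodule A M} (hC : Disjoint (sSup T) C) :
    sSupIndep (insert C T) := by
  intro a ha
  by_cases haC : a = C
  · subst haC
    refine hC.symm.mono_right (sSup_le_sSup ?_)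
    rintro b ⟨hb, hb'⟩
    exact hb.resolve_left hb'
  · have haT : a ∈ T := ha.resolve_left haC
    have h1 : Disjoint a (sSup (T \ {a})) := hT haT
    have h2 : Disjoint (a ⊔ sSup (T \ {a})) C :=
      hC.mono_left (sup_le (le_sSup haT) (sSup_le_sSup Set.sdiff_subset))
    have h3 := h1.disjoint_sup_right_of_disjoint_sup_left h2
    refine h3.mono_right (sSup_le ?_)
    rintro b ⟨hb, hb'⟩
    rcases hb with rfl | hb
    · exact le_sup_right
    · exact (le_sSup (show b ∈ T \ {a} from ⟨hb, hb'⟩)).trans le_sup_left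

lemma projective_of_sSupIndep {A M : Type*} [CommRing A] [AddCommGroup M] [Module A M]
    {T : Set (Submodule A M)} (hT : sSupIndep T) (htop : sSup T = ⊤)
    (hp : ∀ C ∈ T, Module.Projective A C) : Module.Projective A M := by
  classical
  have hinternal : DirectSum.IsInternal (fun C : T => (C : Submodule A M)) :=
    DirectSum.isInternal_submodule_of_iSupIndep_of_iSup_eq_top
      ((sSupIndep_iff T).1 hT) (by rw [← sSup_eq_iSup', htop])
  have : ∀ C : T, Module.Projective A (C : Submodule A M) := fun C => hp C C.2
  exact Module.Projective.of_equiv (LinearEquiv.ofBijective (DirectSum.coeLinearMap _) hinternal)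

theorem projective_descent {A B : Type*} [CommRing A] [CommRing B] [Algebra A B]
    [Module.FaithfullyFlat A B] {M : Type*} [AddCommGroup M] [Module A M]
    [hP : Module.Projective B (B ⊗[A] M)] : Module.Projective A M := by
  classical
  obtain ⟨s, hs'⟩ := hP.out
  let e : (B ⊗[A] M) → B ⊗[A] M := id
  have hs : ∀ z, Finsupp.linearCombination B e (s z) = z := hs'
  let Z : Set (Set (Submodule A M)) := {T | sSupIndep T ∧ (∀ C ∈ T, Module.Projective A C) ∧
    Adapted s e (sSup T)}
  obtain ⟨T, hT⟩ : ∃ T, Maximal (· ∈ Z) T := by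
    refine zorn_subset Z fun c hcZ hc => ⟨⋃₀ c, ⟨?_, ?_, ?_⟩, fun t ht => Set.subset_sUnion_of_mem ht⟩
    · exact iSupIndep_sUnion_of_directed hc.directedOn fun a ha => (hcZ ha).1
    · rintro C ⟨t, ht, hCt⟩
      exact (hcZ ht).2.1 C hCt
    · have : sSup (⋃₀ c) = sSup (Set.image sSup c) := by
        rw [sSup_sUnion, sSup_image]
      rw [this]
      apply adapted_sSup
      rintro _ ⟨t, ht, rfl⟩
      exact (hcZ ht).2.2
  obtain ⟨hind, hproj, had⟩ := hT.prop
  refine projective_of_sSupIndep hind ?_ hproj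
  by_contra hne
  obtain ⟨x, hx⟩ : ∃ x, x ∉ sSup T := by
    by_contra! hall
    exact hne (eq_top_iff.2 fun x _ => hall x)
  obtain ⟨D, hD, hxD, hDad⟩ := exists_adapted_countable s e x
  set N := sSup T with hN
  let N' := N ⊔ Submodule.span A D
  have hle : N ≤ N' := le_sup_left
  have hN'ad : Adapted s e N' := by
    have := adapted_sSup s e {N, Submodule.span A D} (by
      rintro _ (rfl | rfl)
      · exact had
      · exact hDad)
    rwa [sSup_pair] at this
  have := projective_baseChange_quotient s e hs hle had hN'ad
  have hDle : ∀ d ∈ D, d ∈ N' := fun d hd => (le_sup_right : _ ≤ N') (Submodule.subset_span hd)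
  obtain ⟨c, hc⟩ := hD.exists_eq_range ⟨x, hxD⟩
  have hcD : ∀ k, c k ∈ D := fun k => hc ▸ Set.mem_range_self k
  have : Module.Projective A (N' ⧸ N.submoduleOf N') := by
    refine projective_of_countable (B := B)
      (fun k => (N.submoduleOf N').mkQ ⟨c k, hDle _ (hcD k)⟩) ?_
    rw [eq_top_iff]
    rintro y -
    obtain ⟨⟨y, hy⟩, rfl⟩ := Submodule.mkQ_surjective _ y
    obtain ⟨u, hu, v, hv, rfl⟩ := Submodule.mem_sup.1 hy
    have hvN : v ∈ N' := (le_sup_right : _ ≤ N') hv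
    have h1 : (N.submoduleOf N').mkQ ⟨u + v, hy⟩ = (N.submoduleOf N').mkQ ⟨v, hvN⟩ := by
      refine (Submodule.Quotient.eq _).2 ?_
      change (u + v) - v ∈ N
      simpa using hu
    rw [h1]
    have h2 : ∀ v (hv : v ∈ Submodule.span A D) (hvN : v ∈ N'),
        (N.submoduleOf N').mkQ ⟨v, hvN⟩ ∈ Submodule.span A
          (Set.range fun k => (N.submoduleOf N').mkQ ⟨c k, hDle _ (hcD k)⟩) := by
      intro v hv
      induction hv using Submodule.span_induction with
      | mem d hd =>
        intro _
        rw [hc] at hd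
        obtain ⟨k, rfl⟩ := hd
        exact Submodule.subset_span ⟨k, rfl⟩
      | zero =>
        intro h0
        exact Submodule.zero_mem _
      | add a b ha hb iha ihb =>
        intro hab
        exact Submodule.add_mem _ (iha ((le_sup_right : _ ≤ N') ha)) (ihb ((le_sup_right : _ ≤ N') hb))
      | smul r a ha iha =>
        intro hra
        exact Submodule.smul_mem _ r (iha ((le_sup_right : _ ≤ N') ha))
    exact h2 v hv hvN
  obtain ⟨C, hCp, hCd, hCs⟩ := exists_complement hle
  have hins : insert C T ∈ Z := by
    refine ⟨sSupIndep_insert hind hCd, ?_, ?_⟩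
    · rintro C' (rfl | h')
      · exact hCp
      · exact hproj _ h'
    · rw [sSup_insert, sup_comm, ← hN, hCs]
      exact hN'ad
  have hsub := hT.le_of_ge hins (Set.subset_insert C T)
  have hCN : C ≤ N := le_sSup (hsub (Set.mem_insert C T))
  have : N' = N := by rw [← hCs, sup_eq_left.2 hCN]
  exact hx (this ▸ hDle x hxD)

open CategoryTheory.MonoidalCategory

lemma tor_iff {R : Type u} [CommRing R] {X : ModuleCat.{u} R} (P : ProjectiveResolution X) (n : ℕ)
    (N : ModuleCat.{u} R) :
    IsZero (((Tor' (ModuleCat.{u} R) (n + 1)).obj X).obj N) ↔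
      Function.Exact ((P.complex.d (n + 2) (n + 1)).hom.rTensor N)
        ((P.complex.d (n + 1) n).hom.rTensor N) := by
  rw [Tor'_obj_obj, (P.isoLeftDerivedObj ((tensoringRight (ModuleCat.{u} R)).obj N) (n + 1)).isZero_iff]
  change IsZero (((((tensoringRight (ModuleCat.{u} R)).obj N).mapHomologicalComplex _).obj
    P.complex).homology (n + 1)) ↔ _
  rw [← HomologicalComplex.exactAt_iff_isZero_homology,
    HomologicalComplex.exactAt_iff' _ (n + 2) (n + 1) n (by simp) (by simp),
    ShortComplex.ShortExact.moduleCat_exact_iff_function_exact]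
  rfl

lemma ext_iff_aux {R : Type u} [CommRing R] {X : ModuleCat.{u} R} (P : ProjectiveResolution X)
    (n : ℕ) (Y : ModuleCat.{u} R) :
    IsZero (((Ext R (ModuleCat.{u} R) (n + 1)).obj (Opposite.op X)).obj Y) ↔
      ∀ g : P.complex.X (n + 1) ⟶ Y, P.complex.d (n + 2) (n + 1) ≫ g = 0 →
        ∃ h : P.complex.X n ⟶ Y, P.complex.d (n + 1) n ≫ h = g := by
  rw [(P.isoExt (R := R) (n + 1) Y).isZero_iff, ← HomologicalComplex.exactAt_iff_isZero_homology,
    HomologicalComplex.exactAt_iff' _ n (n + 1) (n + 2) (by simp) (by simp),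
    ShortComplex.moduleCat_exact_iff]
  rfl

lemma ext_iff {R : Type u} [CommRing R] {X : ModuleCat.{u} R} (P : ProjectiveResolution X)
    (n : ℕ) :
    (∀ Y, IsZero (((Ext R (ModuleCat.{u} R) (n + 1)).obj (Opposite.op X)).obj Y)) ↔
      Module.Projective R (P.complex.X n ⧸ LinearMap.range (P.complex.d (n + 1) n).hom) := by
  simp only [ext_iff_aux P]
  set d := (P.complex.d (n + 1) n).hom with hd
  have hdd : ∀ x, d ((P.complex.d (n + 2) (n + 1)).hom x) = 0 := by
    intro x
    rw [hd, ← ModuleCat.comp_apply, P.complex.d_comp_d]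
    rfl
  have hex : ∀ x, d x = 0 → ∃ y, (P.complex.d (n + 2) (n + 1)).hom y = x := by
    have := P.complex_exactAt_succ n
    rw [HomologicalComplex.exactAt_iff' _ (n + 2) (n + 1) n (by simp) (by simp),
      ShortComplex.moduleCat_exact_iff] at this
    exact this
  have hproj : Module.Projective R (P.complex.X n) :=
    (IsProjective.iff_projective _).2 (P.projective n)
  constructor
  · intro h
    obtain ⟨r, hr⟩ := h (ModuleCat.of R (LinearMap.range d)) (ModuleCat.ofHom d.rangeRestrict) (by
      ext x
      exact hdd x)
    have hr' : ∀ y ∈ LinearMap.range d, (r.hom y : P.complex.X n) = y := by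
      rintro _ ⟨x, rfl⟩
      have := ConcreteCategory.congr_hom hr x
      exact congrArg Subtype.val this
    let t : P.complex.X n →ₗ[R] P.complex.X n := LinearMap.id - (LinearMap.range d).subtype ∘ₗ r.hom
    have ht : LinearMap.range d ≤ LinearMap.ker t := by
      intro y hy
      simp [t, hr' y hy]
    refine Module.Projective.of_split ((LinearMap.range d).liftQ t ht) (LinearMap.range d).mkQ ?_
    refine LinearMap.ext fun y => ?_
    obtain ⟨y, rfl⟩ := Submodule.mkQ_surjective _ y
    refine (Submodule.Quotient.eq _).2 ?_
    simp [t]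
  · intro h Y g hg
    obtain ⟨j, hj⟩ := Module.projective_lifting_property (LinearMap.range d).mkQ LinearMap.id
      (Submodule.mkQ_surjective _)
    let e : P.complex.X n →ₗ[R] P.complex.X n := LinearMap.id - j ∘ₗ (LinearMap.range d).mkQ
    have he : ∀ y, e y ∈ LinearMap.range d := by
      intro y
      rw [← Submodule.Quotient.mk_eq_zero]
      have := LinearMap.congr_fun hj ((LinearMap.range d).mkQ y)
      simp only [LinearMap.comp_apply, LinearMap.id_apply] at this
      change (LinearMap.range d).mkQ (y - j ((LinearMap.range d).mkQ y)) = 0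
      rw [map_sub, this, sub_self]
    have hed : ∀ x, e (d x) = d x := by
      intro x
      have : (LinearMap.range d).mkQ (d x) = 0 := (Submodule.Quotient.mk_eq_zero _).2 ⟨x, rfl⟩
      simp [e, this]
    have hker : LinearMap.ker d ≤ LinearMap.ker g.hom := by
      intro x hx
      obtain ⟨y, rfl⟩ := hex x hx
      exact ConcreteCategory.congr_hom hg y
    let g' : LinearMap.range d →ₗ[R] Y :=
      (LinearMap.ker d).liftQ g.hom hker ∘ₗ d.quotKerEquivRange.symm.toLinearMap
    have hg' : ∀ x, g' ⟨d x, LinearMap.mem_range_self d x⟩ = g.hom x := by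
      intro x
      exact congrArg ((LinearMap.ker d).liftQ g.hom hker)
        (d.quotKerEquivRange_symm_apply_image x (LinearMap.mem_range_self d x))
    refine ⟨ModuleCat.ofHom (g' ∘ₗ e.codRestrict _ he), ?_⟩
    ext x
    change g' ⟨e (d x), _⟩ = g.hom x
    rw [← hg' x]
    congr 1
    exact Subtype.ext (hed x)


/-- Base change of modules as a functor. -/
def bc (A B : Type u) [CommRing A] [CommRing B] [Algebra A B] :
    ModuleCat.{u} A ⥤ ModuleCat.{u} B where
  obj X := ModuleCat.of B (B ⊗[A] X)
  map f := ModuleCat.ofHom (f.hom.baseChange B)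
  map_id X := by
    ext1
    exact LinearMap.baseChange_id
  map_comp f g := by
    ext1
    exact LinearMap.baseChange_comp _ _

instance bc_additive (A B : Type u) [CommRing A] [CommRing B] [Algebra A B] : (bc A B).Additive where
  map_add {X Y f g} := by
    ext1
    exact LinearMap.baseChange_add _ _

instance bc_projective (A B : Type u) [CommRing A] [CommRing B] [Algebra A B] :
    (bc A B).PreservesProjectiveObjects where
  projective_obj {X} hX := by
    have : Module.Projective A X := (IsProjective.iff_projective _).2 hX
    exact (IsProjective.iff_projective (R := B) (B ⊗[A] X)).1 inferInstance

instance bc_homology (A B : Type u) [CommRing A] [CommRing B] [Algebra A B] [Module.Flat A B] :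
    (bc A B).PreservesHomology := by
  refine Functor.preservesHomology_of_map_exact _ fun S hS => ?_
  rw [ShortComplex.ShortExact.moduleCat_exact_iff_function_exact] at hS ⊢
  exact Module.Flat.lTensor_exact B hS

lemma exact_rTensor_baseChange {A B : Type*} [CommRing A] [CommRing B] [Algebra A B]
    {X Y Z : Type*} [AddCommGroup X] [AddCommGroup Y] [AddCommGroup Z] [Module A X] [Module A Y]
    [Module A Z] (f : X →ₗ[A] Y) (g : Y →ₗ[A] Z) (N : Type*) [AddCommGroup N] [Module B N]
    [Module A N] [IsScalarTower A B N] (h : Function.Exact (f.rTensor N) (g.rTensor N)) :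
    Function.Exact ((f.baseChange B).rTensor N) ((g.baseChange B).rTensor N) := by
  rw [LinearMap.rTensor_exact_iff_lTensor_exact] at h ⊢
  refine (Function.Exact.iff_of_ladder_linearEquiv (R := B)
    (e₁ := TensorProduct.AlgebraTensorModule.cancelBaseChange A B B N X)
    (e₂ := TensorProduct.AlgebraTensorModule.cancelBaseChange A B B N Y)
    (e₃ := TensorProduct.AlgebraTensorModule.cancelBaseChange A B B N Z)
    (f₁₂ := (f.baseChange B).lTensor N) (f₂₃ := (g.baseChange B).lTensor N)
    (g₁₂ := TensorProduct.AlgebraTensorModule.lTensor B N f)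
    (g₂₃ := TensorProduct.AlgebraTensorModule.lTensor B N g) ?_ ?_).1 h
  · exact TensorProduct.AlgebraTensorModule.lTensor_comp_cancelBaseChange _ _ _ f
  · exact TensorProduct.AlgebraTensorModule.lTensor_comp_cancelBaseChange _ _ _ g

lemma projective_baseChange_coker {A B : Type*} [CommRing A] [CommRing B] [Algebra A B]
    {X Y : Type*} [AddCommGroup X] [AddCommGroup Y] [Module A X] [Module A Y]
    (f : X →ₗ[A] Y) [Module.Projective B ((B ⊗[A] Y) ⧸ LinearMap.range (f.baseChange B))] :
    Module.Projective B (B ⊗[A] (Y ⧸ LinearMap.range f)) := by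
  have hex : Function.Exact (f.baseChange B) ((LinearMap.range f).mkQ.baseChange B) :=
    lTensor_exact B (f := f) (g := (LinearMap.range f).mkQ)
      (by rw [LinearMap.exact_iff, Submodule.ker_mkQ]) (Submodule.mkQ_surjective _)
  have hsurj : Function.Surjective ((LinearMap.range f).mkQ.baseChange B) :=
    LinearMap.lTensor_surjective B (Submodule.mkQ_surjective (LinearMap.range f))
  exact Module.Projective.of_equiv
    ((Submodule.quotEquivOfEq _ _ hex.linearMap_ker_eq.symm).trans
      (LinearMap.quotKerEquivOfSurjective _ hsurj))

end SNP

theorem strongNPerfect_descends_faithfullyFlat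
    (A B : Type u) [CommRing A] [CommRing B] [Algebra A B]
    [Module.FaithfullyFlat A B]
    (n : ℕ) (hB : IsStrongNPerfect B n) :
    IsStrongNPerfect A n := by
  intro M _ _ hfd
  let P : ProjectiveResolution (ModuleCat.of A M) := projectiveResolution _
  let PB : ProjectiveResolution ((SNP.bc A B).obj (ModuleCat.of A M)) :=
    (SNP.bc A B).mapProjectiveResolution P
  have hfdB : fdLE B (TensorProduct A B M) n := by
    intro N
    refine (SNP.tor_iff PB n N).2 ?_
    let _ : Module A N := Module.compHom N (algebraMap A B)
    have : IsScalarTower A B N := IsScalarTower.of_algebraMap_smul fun _ _ => rfl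
    exact SNP.exact_rTensor_baseChange (B := B) _ _ N ((SNP.tor_iff P n (ModuleCat.of A N)).1 (hfd _))
  have hpB : Module.Projective B
      (TensorProduct A B (P.complex.X n) ⧸
        LinearMap.range ((P.complex.d (n + 1) n).hom.baseChange B)) :=
    (SNP.ext_iff PB n).1 (hB _ hfdB)
  have := SNP.projective_baseChange_coker (B := B) (P.complex.d (n + 1) n).hom
  exact (SNP.ext_iff P n).2 (SNP.projective_descent (B := B))
end
end

section
/- Let A be a commutative ring, M a flat A-module, and R = A ⋉ M the trivial extension (idealization) of A by M. If R is a strong n-perfect ring, then A is a strong n-perfect ring. -/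
open CategoryTheory CategoryTheory.Limits

noncomputable section

universe u

open TensorProduct MonoidalCategory

theorem lTensor_exact_iff_rTensor_exact' {A : Type*} [CommRing A] (X : Type*) [AddCommGroup X] [Module A X]
    {P Q S : Type*} [AddCommGroup P] [Module A P] [AddCommGroup Q] [Module A Q] [AddCommGroup S] [Module A S]
    (f : P →ₗ[A] Q) (g : Q →ₗ[A] S) :
    Function.Exact (f.rTensor X) (g.rTensor X) ↔ Function.Exact (f.lTensor X) (g.lTensor X) := by
  apply Function.Exact.iff_of_ladder_linearEquiv (e₁ := TensorProduct.comm A X P)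
    (e₂ := TensorProduct.comm A X Q) (e₃ := TensorProduct.comm A X S)
  · ext; simp
  · ext; simp

theorem tor_criterion {A : Type u} [CommRing A] {N : ModuleCat.{u} A} (P : ProjectiveResolution N)
    (X : ModuleCat.{u} A) (n : ℕ) :
    IsZero (((Tor' (ModuleCat.{u} A) (n + 1)).obj N).obj X) ↔
      Function.Exact ((P.complex.d (n+2) (n+1)).hom.lTensor X) ((P.complex.d (n+1) n).hom.lTensor X) := by
  rw [← lTensor_exact_iff_rTensor_exact']
  have e : ((Tor' (ModuleCat.{u} A) (n + 1)).obj N).obj X ≅ _ :=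
    P.isoLeftDerivedObj ((tensoringRight (ModuleCat.{u} A)).obj X) (n+1)
  rw [e.isZero_iff]
  erw [← HomologicalComplex.exactAt_iff_isZero_homology]
  rw [HomologicalComplex.exactAt_iff' _ (n+2) (n+1) n (by simp only [ChainComplex.prev]; rfl) (by simp),
    ShortComplex.ShortExact.moduleCat_exact_iff_function_exact]
  rfl

theorem ext_criterion {A : Type u} [CommRing A] {N : ModuleCat.{u} A} (P : ProjectiveResolution N)
    (X : ModuleCat.{u} A) (n : ℕ) :
    IsZero (((Ext A (ModuleCat.{u} A) (n + 1)).obj (Opposite.op N)).obj X) ↔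
      ∀ φ : P.complex.X (n+1) ⟶ X, P.complex.d (n+2) (n+1) ≫ φ = 0 →
        ∃ g : P.complex.X n ⟶ X, P.complex.d (n+1) n ≫ g = φ := by
  rw [(P.isoExt (R := A) (n+1) X).isZero_iff, ← HomologicalComplex.exactAt_iff_isZero_homology,
    HomologicalComplex.exactAt_iff' _ n (n+1) (n+2) (by simp) (by simp),
    ShortComplex.moduleCat_exact_iff]
  rfl

/-- base change -/
def bc (A R : Type u) [CommRing A] [CommRing R] [Algebra A R] :
    ModuleCat.{u} A ⥤ ModuleCat.{u} R where
  obj N := ModuleCat.of R (R ⊗[A] N)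
  map g := ModuleCat.ofHom (g.hom.baseChange R)
  map_id N := by ext; simp
  map_comp f g := by ext; simp

section
variable (A R : Type u) [CommRing A] [CommRing R] [Algebra A R]

instance : (bc A R).Additive where
  map_add {_ _ f g} := by
    ext1
    exact LinearMap.baseChange_add _ _

instance : (bc A R).PreservesProjectiveObjects where
  projective_obj {N} h := by
    rw [← IsProjective.iff_projective] at h
    exact (IsProjective.iff_projective (R := R) (R ⊗[A] N)).1 inferInstance

instance [Module.Flat A R] : (bc A R).PreservesHomology :=
  Functor.preservesHomology_of_map_exact _ fun S hS => by
    rw [ShortComplex.ShortExact.moduleCat_exact_iff_function_exact] at hS ⊢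
    exact Module.Flat.lTensor_exact R hS

theorem fd_bc [Module.Flat A R] (N : Type u) [AddCommGroup N] [Module A N] (n : ℕ)
    (h : fdLE A N n) : fdLE R (R ⊗[A] N) n := by
  intro X
  let P := ProjectiveResolution.of (ModuleCat.of A N)
  let _ : Module A X := Module.compHom X (algebraMap A R)
  have : IsScalarTower A R X := IsScalarTower.of_algebraMap_smul fun _ _ => rfl
  have h1 := (tor_criterion P (ModuleCat.of A X) n).1 (h _)
  refine (tor_criterion ((bc A R).mapProjectiveResolution P) X n).2 ?_
  let e := fun i => (AlgebraTensorModule.cancelBaseChange A R R X (P.complex.X i))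
  refine (Function.Exact.iff_of_ladder_addEquiv (e₁ := (e (n+2)).toAddEquiv)
    (e₂ := (e (n+1)).toAddEquiv) (e₃ := (e n).toAddEquiv)
    (g₁₂ := ((P.complex.d (n+2) (n+1)).hom.lTensor X).toAddMonoidHom)
    (g₂₃ := ((P.complex.d (n+1) n).hom.lTensor X).toAddMonoidHom)
    (f₁₂ := ((((P.complex.d (n+2) (n+1)).hom.baseChange R)).lTensor X).toAddMonoidHom)
    (f₂₃ := (((P.complex.d (n+1) n).hom.baseChange R).lTensor X).toAddMonoidHom) ?_ ?_).1 h1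
  all_goals
    ext z
    induction z using TensorProduct.induction_on with
    | zero => simp
    | add a b ha hb => rw [map_add, map_add, ha, hb]
    | tmul x y =>
      induction y using TensorProduct.induction_on with
      | zero => simp
      | add a b ha hb => rw [tmul_add, map_add, map_add, ha, hb]
      | tmul r p => simp [e]

theorem pd_of_bc [Module.Flat A R] (s : R →ₐ[A] A) (N : Type u) [AddCommGroup N] [Module A N]
    (n : ℕ) (h : pdLE R (R ⊗[A] N) n) : pdLE A N n := by
  intro X
  let P := ProjectiveResolution.of (ModuleCat.of A N)
  let _ : Module R X := Module.compHom X s.toRingHom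
  have : IsScalarTower A R X := IsScalarTower.of_algebraMap_smul fun a x => by
    change s (algebraMap A R a) • x = a • x
    rw [s.commutes]; rfl
  have h1 := (ext_criterion ((bc A R).mapProjectiveResolution P) (ModuleCat.of R X) n).1 (h _)
  refine (ext_criterion P X n).2 fun φ hφ => ?_
  obtain ⟨g, hg⟩ := h1 (ModuleCat.ofHom (φ.hom.liftBaseChange R)) (by
    ext1
    change (φ.hom.liftBaseChange R).comp ((P.complex.d (n+2) (n+1)).hom.baseChange R) = 0
    ext p
    simpa using congr($hφ p))
  let g' : R ⊗[A] (P.complex.X n) →ₗ[R] X := g.hom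
  refine ⟨ModuleCat.ofHom ((g'.restrictScalars A).comp (TensorProduct.mk A R _ 1)), ?_⟩
  ext p
  have h2 : g' ((P.complex.d (n+1) n).hom.baseChange R (1 ⊗ₜ p)) =
    φ.hom.liftBaseChange R (1 ⊗ₜ p) := congr(($hg).hom (1 ⊗ₜ p))
  simpa using h2
end

theorem flat_prod (A M N : Type u) [CommRing A] [AddCommGroup M] [Module A M] [AddCommGroup N]
    [Module A N] [Module.Flat A M] [Module.Flat A N] : Module.Flat A (M × N) := by
  rw [Module.Flat.iff_lTensor_preserves_injective_linearMap]
  intro K L _ _ _ _ f hf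
  have key : (TensorProduct.prodLeft A A M N L).toLinearMap ∘ₗ f.lTensor (M × N) =
      ((f.lTensor M).prodMap (f.lTensor N)) ∘ₗ (TensorProduct.prodLeft A A M N K).toLinearMap := by
    ext <;> simp
  have inj : Function.Injective
      ((TensorProduct.prodLeft A A M N L).toLinearMap ∘ₗ f.lTensor (M × N)) := by
    rw [key]
    exact (Function.Injective.prodMap
      (Module.Flat.lTensor_preserves_injective_linearMap f hf)
      (Module.Flat.lTensor_preserves_injective_linearMap f hf)).comp
      (TensorProduct.prodLeft A A M N K).injective
  rw [LinearMap.coe_comp] at inj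
  exact Function.Injective.of_comp inj

theorem strongNPerfect_of_trivialExtension
    (A : Type u) [CommRing A] (M : Type u) [AddCommGroup M] [Module A M] [Module Aᵐᵒᵖ M] [IsCentralScalar A M]
    (hflat : Module.Flat A M) (n : ℕ)
    (hR : IsStrongNPerfect (TrivSqZeroExt A M) n) :
    IsStrongNPerfect A n := by
  have : Module.Flat A (TrivSqZeroExt A M) :=
    flat_prod A A M
  intro N _ _ hN
  exact pd_of_bc A (TrivSqZeroExt A M) (TrivSqZeroExt.fstHom A A M) N n
    (hR _ (fd_bc A (TrivSqZeroExt A M) N n hN))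
end
end

section
/- If the polynomial ring R[X] over a commutative ring R is strong n-perfect, then R is strong n-perfect. -/
open CategoryTheory CategoryTheory.Limits

noncomputable section

universe u

section aux
open TensorProduct

variable {R : Type u} [CommRing R]

lemma aux_tor_iff {M : ModuleCat.{u} R} (P : ProjectiveResolution M) (N : ModuleCat.{u} R) (n : ℕ) :
    IsZero (((Tor' (ModuleCat.{u} R) (n + 1)).obj M).obj N) ↔
      Function.Exact ((P.complex.d (n+2) (n+1)).hom.rTensor N)
        ((P.complex.d (n+1) n).hom.rTensor N) := by
  have e : ((Tor' (ModuleCat.{u} R) (n + 1)).obj M).obj N ≅ _ :=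
    P.isoLeftDerivedObj ((MonoidalCategory.tensoringRight (ModuleCat.{u} R)).obj N) (n+1)
  rw [e.isZero_iff]
  change IsZero (HomologicalComplex.homology _ _) ↔ _
  rw [← HomologicalComplex.exactAt_iff_isZero_homology,
    HomologicalComplex.exactAt_iff' _ (n+2) (n+1) n (by simp) (by simp),
    ShortComplex.ShortExact.moduleCat_exact_iff_function_exact]
  rfl

lemma aux_ext_iff {M : ModuleCat.{u} R} (P : ProjectiveResolution M) (N : ModuleCat.{u} R) (n : ℕ) :
    IsZero (((Ext R (ModuleCat.{u} R) (n + 1)).obj (Opposite.op M)).obj N) ↔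
      ∀ f : P.complex.X (n+1) ⟶ N, P.complex.d (n+2) (n+1) ≫ f = 0 →
        ∃ g : P.complex.X n ⟶ N, P.complex.d (n+1) n ≫ g = f := by
  rw [(P.isoExt (R := R) (n+1) N).isZero_iff,
    ← HomologicalComplex.exactAt_iff_isZero_homology,
    HomologicalComplex.exactAt_iff' _ n (n+1) (n+2) (by simp) (by simp),
    ShortComplex.moduleCat_exact_iff]
  rfl

lemma aux_exact {S : Type u} [CommRing S] [Algebra R S] {A B C N : Type u} [AddCommGroup A]
    [AddCommGroup B] [AddCommGroup C] [AddCommGroup N] [Module R A] [Module R B] [Module R C]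
    [Module R N] [Module S N] [IsScalarTower R S N] (f : A →ₗ[R] B) (g : B →ₗ[R] C)
    (h : Function.Exact (f.rTensor N) (g.rTensor N)) :
    Function.Exact ((f.baseChange S).rTensor N) ((g.baseChange S).rTensor N) := by
  rw [LinearMap.rTensor_exact_iff_lTensor_exact] at h ⊢
  have H : ∀ {A B : Type u} [AddCommGroup A] [AddCommGroup B] [Module R A] [Module R B]
      (f : A →ₗ[R] B), 
      (f.lTensor N).toAddMonoidHom.comp
        (AlgebraTensorModule.cancelBaseChange R S S N A).toAddEquiv.toAddMonoidHom =
      (AlgebraTensorModule.cancelBaseChange R S S N B).toAddEquiv.toAddMonoidHom.comp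
        ((f.baseChange S).lTensor N).toAddMonoidHom := by
    intro A B _ _ _ _ f
    ext x
    exact LinearMap.congr_fun (AlgebraTensorModule.lTensor_comp_cancelBaseChange R S S f) x
  exact (Function.Exact.iff_of_ladder_addEquiv
    (f₁₂ := ((f.baseChange S).lTensor N).toAddMonoidHom)
    (f₂₃ := ((g.baseChange S).lTensor N).toAddMonoidHom)
    (g₁₂ := (f.lTensor N).toAddMonoidHom)
    (g₂₃ := (g.lTensor N).toAddMonoidHom)
    (AlgebraTensorModule.cancelBaseChange R S S N A).toAddEquiv
    (AlgebraTensorModule.cancelBaseChange R S S N B).toAddEquiv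
    (AlgebraTensorModule.cancelBaseChange R S S N C).toAddEquiv (H f) (H g)).1 h

lemma aux_exact' {S : Type u} [CommRing S] (f : R →+* S) (L : ModuleCat.{u} S)
    {A B C : ModuleCat.{u} R} (a : A ⟶ B) (b : B ⟶ C)
    (h : Function.Exact (a.hom.rTensor ((ModuleCat.restrictScalars.{u} f).obj L))
      (b.hom.rTensor ((ModuleCat.restrictScalars.{u} f).obj L))) :
    Function.Exact (((ModuleCat.extendScalars.{u, u, u} f).map a).hom.rTensor L)
      (((ModuleCat.extendScalars.{u, u, u} f).map b).hom.rTensor L) := by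
  let _ : Algebra R S := f.toAlgebra
  let _ : Module R L := Module.compHom L f
  have _ : IsScalarTower R S L := ⟨fun x y z => mul_smul (f x) y z⟩
  exact aux_exact (S := S) (N := L) a.hom b.hom h

end aux

theorem strongNPerfect_of_polynomial
    (R : Type u) [CommRing R] (n : ℕ)
    (h : IsStrongNPerfect (Polynomial R) n) :
    IsStrongNPerfect R n := by
  intro M _ _ hM N
  let f : R →+* Polynomial R := Polynomial.C
  have hf : f.Flat := by
    have : (algebraMap R (Polynomial R)).Flat := RingHom.flat_algebraMap_iff.2 inferInstance
    exact this
  let F := ModuleCat.extendScalars.{u, u, u} f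
  let G := ModuleCat.restrictScalars.{u} f
  let adj : F ⊣ G := ModuleCat.extendRestrictScalarsAdj f
  have : PreservesFiniteLimits F := ModuleCat.preservesFiniteLimits_extendScalars_of_flat hf
  have : PreservesFiniteColimits F :=
    have := adj.leftAdjoint_preservesColimits
    inferInstance
  have : F.Additive := Functor.additive_of_preserves_binary_products F
  have : F.PreservesProjectiveObjects := ⟨fun hX => adj.map_projective _ hX⟩
  let P := ProjectiveResolution.of (ModuleCat.of R M)
  let Q := F.mapProjectiveResolution P
  have h1 : fdLE (Polynomial R) (F.obj (ModuleCat.of R M)) n := by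
    intro L
    refine (aux_tor_iff Q L n).2 ?_
    have key := (aux_tor_iff P (G.obj L) n).1 (hM _)
    exact aux_exact' f L _ _ key
  have h2 := h _ h1
  let N' : ModuleCat.{u} (Polynomial R) :=
    (ModuleCat.restrictScalars.{u} (Polynomial.evalRingHom (0:R))).obj N
  have e : G.obj N' ≅ N := 
    (ModuleCat.restrictScalarsComp'App f (Polynomial.evalRingHom (0:R)) (RingHom.id R)
      (by ext r; simp [f]) N).symm ≪≫ ModuleCat.restrictScalarsId'App _ rfl N
  refine (((Ext R (ModuleCat.{u} R) (n + 1)).obj _).mapIso e).isZero_iff.1 ?_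
  refine (aux_ext_iff P _ n).2 ?_
  intro φ hφ
  have h3 := (aux_ext_iff Q N' n).1 (h2 N') ((adj.homEquiv _ _).symm φ) (by
    change F.map _ ≫ _ = 0
    rw [← adj.homEquiv_naturality_left_symm, hφ]
    apply (adj.homEquiv _ _).injective
    rw [Equiv.apply_symm_apply, adj.homEquiv_unit]
    simp)
  obtain ⟨g, hg⟩ := h3
  refine ⟨adj.homEquiv _ _ g, ?_⟩
  apply (adj.homEquiv _ _).symm.injective
  refine (adj.homEquiv_naturality_left_symm _ _).trans ?_
  refine Eq.trans ?_ hg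
  exact congrArg (F.map (P.complex.d (n+1) n) ≫ ·) ((adj.homEquiv _ _).symm_apply_apply g)
end
end

section
/- A finite direct product ∏_{i=1}^m R_i of commutative rings is strong n-perfect if and only if each R_i is strong n-perfect. -/
open CategoryTheory CategoryTheory.Limits

noncomputable section

universe u

theorem fdLE_iff_aux (R : Type u) [CommRing R] (M : ModuleCat.{u} R)
    (P : ProjectiveResolution M) (n : ℕ) :
    fdLE R M n ↔ ∀ N : ModuleCat.{u} R,
      Function.Exact (LinearMap.rTensor N (P.complex.d (n + 2) (n + 1)).hom)
        (LinearMap.rTensor N (P.complex.d (n + 1) n).hom) := by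
  unfold fdLE
  refine forall_congr' fun N => ?_
  change IsZero ((((MonoidalCategory.tensoringRight (ModuleCat.{u} R)).obj N).leftDerived
    (n + 1)).obj M) ↔ _
  rw [(P.isoLeftDerivedObj ((MonoidalCategory.tensoringRight (ModuleCat.{u} R)).obj N)
    (n + 1)).isZero_iff]
  erw [← HomologicalComplex.exactAt_iff_isZero_homology]
  rw [HomologicalComplex.exactAt_iff' _ (n + 2) (n + 1) n (by simp) (by simp)]
  rw [ShortComplex.ShortExact.moduleCat_exact_iff_function_exact]
  rfl

theorem pdLE_iff_aux (R : Type u) [CommRing R] (M : ModuleCat.{u} R)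
    (P : ProjectiveResolution M) (n : ℕ) :
    pdLE R M n ↔ ∃ r : P.complex.X n ⟶ P.complex.X (n + 1),
      P.complex.d (n + 1) n ≫ r ≫ P.complex.d (n + 1) n = P.complex.d (n + 1) n := by
  have key : pdLE R M n ↔ ∀ (N : ModuleCat.{u} R) (g : P.complex.X (n + 1) ⟶ N),
      P.complex.d (n + 2) (n + 1) ≫ g = 0 → ∃ h, P.complex.d (n + 1) n ≫ h = g := by
    unfold pdLE
    refine forall_congr' fun N => ?_
    rw [(P.isoExt (n + 1) N).isZero_iff, ← HomologicalComplex.exactAt_iff_isZero_homology,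
      HomologicalComplex.exactAt_iff' _ n (n + 1) (n + 2) (by simp) (by simp),
      ShortComplex.moduleCat_exact_iff]
    rfl
  rw [key]
  have hex := P.exact_succ n
  constructor
  · intro H
    obtain ⟨h, hh⟩ := H _ (Abelian.factorThruImage (P.complex.d (n + 1) n)) (by
      rw [← cancel_mono (Abelian.image.ι _)]
      simp)
    refine ⟨Projective.factorThru h (Abelian.factorThruImage (P.complex.d (n + 1) n)), ?_⟩
    have e : Projective.factorThru h (Abelian.factorThruImage (P.complex.d (n + 1) n)) ≫
        P.complex.d (n + 1) n = h ≫ Abelian.image.ι _ := by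
      have e1 := Projective.factorThru_comp h (Abelian.factorThruImage (P.complex.d (n + 1) n))
      have e2 := Abelian.image.fac (P.complex.d (n + 1) n)
      calc _ = Projective.factorThru h (Abelian.factorThruImage (P.complex.d (n + 1) n)) ≫
            (Abelian.factorThruImage (P.complex.d (n + 1) n) ≫ Abelian.image.ι _) := by rw [e2]
        _ = _ := by rw [← Category.assoc, e1]
    rw [e, ← Category.assoc, hh, Abelian.image.fac]
  · rintro ⟨r, hr⟩ N g hg
    refine ⟨r ≫ g, ?_⟩
    have h0 : (𝟙 _ - P.complex.d (n + 1) n ≫ r) ≫ P.complex.d (n + 1) n = 0 := by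
      simp [hr]
    have h1 : (𝟙 _ - P.complex.d (n + 1) n ≫ r) ≫ g = 0 := by
      have := hex.liftFromProjective_comp (P := P.complex.X (n+1)) _ h0
      dsimp at this
      rw [← this, Category.assoc, hg, comp_zero]
    rw [Preadditive.sub_comp, sub_eq_zero] at h1
    simpa using h1.symm

theorem restrict_preservesProj {S R : Type u} [CommRing S] [CommRing R] (f : S →+* R)
    (hp : letI := f.toAlgebra; Module.Projective S R) :
    (ModuleCat.restrictScalars.{u} f).PreservesProjectiveObjects where
  projective_obj {X} hX := by
    let := f.toAlgebra
    have hX' : Module.Projective R X := (IsProjective.iff_projective _).2 hX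
    let : Module S X := Module.compHom X f
    have : IsScalarTower S R X := ⟨fun a b c => by
      change (f a * b) • c = f a • b • c
      rw [mul_smul]⟩
    have h2 : Module.Projective S X := by
      have hp' : Module.Projective S R := hp
      classical
      have : Module.Projective S (X →₀ R) :=
        Module.Projective.of_equiv (finsuppLequivDFinsupp (ι := X) (M := R) S).symm
      obtain ⟨s, hs⟩ := Module.projective_def'.1 hX'
      exact Module.Projective.of_split (s.restrictScalars S)
        ((Finsupp.linearCombination R (id : X → X)).restrictScalars S)
        (LinearMap.ext fun x => LinearMap.congr_fun hs x)
    exact (IsProjective.iff_projective (R := S) (P := X)).1 h2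

theorem restrict_full {S R : Type u} [CommRing S] [CommRing R] (f : S →+* R)
    (hf : Function.Surjective f) :
    (ModuleCat.restrictScalars.{u} f).Full where
  map_surjective {X Y} g := by
    refine ⟨ModuleCat.ofHom
      { toFun := fun x => (show Y from g.hom (show (ModuleCat.restrictScalars.{u} f).obj X from x)), map_add' := fun a b => map_add g.hom a b,
        map_smul' := fun r x => ?_ }, rfl⟩
    obtain ⟨s, rfl⟩ := hf r
    exact map_smul g.hom s (show (ModuleCat.restrictScalars.{u} f).obj X from x)

theorem pdLE_restrict {S R : Type u} [CommRing S] [CommRing R] (f : S →+* R)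
    (hf : Function.Surjective f) (hp : letI := f.toAlgebra; Module.Projective S R)
    (M : ModuleCat.{u} R) (n : ℕ) :
    pdLE S ((ModuleCat.restrictScalars.{u} f).obj M) n ↔ pdLE R M n := by
  have := restrict_preservesProj f hp
  have := restrict_full f hf
  have P := projectiveResolution M
  rw [pdLE_iff_aux R M P, pdLE_iff_aux S _
    ((ModuleCat.restrictScalars.{u} f).mapProjectiveResolution P)]
  constructor
  · rintro ⟨r, hr⟩
    obtain ⟨r, rfl⟩ := (ModuleCat.restrictScalars.{u} f).map_surjective r
    refine ⟨r, (ModuleCat.restrictScalars.{u} f).map_injective ?_⟩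
    simpa using! hr
  · rintro ⟨r, hr⟩
    refine ⟨(ModuleCat.restrictScalars.{u} f).map r, ?_⟩
    have := congrArg (ModuleCat.restrictScalars.{u} f).map hr
    simpa using! this

open TensorProduct in
theorem exact_tensor_iff_aux {S R : Type u} [CommRing S] [CommRing R] [Algebra S R]
    (hf : Function.Surjective (algebraMap S R))
    (A B C : Type u) [AddCommGroup A] [AddCommGroup B] [AddCommGroup C]
    [Module R A] [Module R B] [Module R C] [Module S A] [Module S B] [Module S C]
    [IsScalarTower S R A] [IsScalarTower S R B] [IsScalarTower S R C]
    (d' : A →ₗ[R] B) (d : B →ₗ[R] C) :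
    (∀ (N : Type u) [AddCommGroup N] [Module S N],
      Function.Exact (LinearMap.rTensor N (d'.restrictScalars S))
        (LinearMap.rTensor N (d.restrictScalars S))) ↔
    (∀ (N : Type u) [AddCommGroup N] [Module R N],
      Function.Exact (LinearMap.rTensor N d') (LinearMap.rTensor N d)) := by
  constructor
  · intro H N _ _
    let : Module S N := Module.compHom N (algebraMap S R)
    have : IsScalarTower S R N := ⟨fun a b c => by
      rw [Algebra.smul_def, mul_smul]; rfl⟩
    have compat (X : Type u) [AddCommGroup X] [Module R X] [Module S X] [IsScalarTower S R X] :
        TensorProduct.CompatibleSMul S R X N := ⟨fun r x y => by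
      obtain ⟨s, rfl⟩ := hf r
      rw [algebraMap_smul, algebraMap_smul, TensorProduct.smul_tmul]⟩
    have := compat A
    have := compat B
    have := compat C
    refine (Function.Exact.iff_of_ladder_addEquiv
      (e₁ := (TensorProduct.equivOfCompatibleSMul S R S A N).toAddEquiv)
      (e₂ := (TensorProduct.equivOfCompatibleSMul S R S B N).toAddEquiv)
      (e₃ := (TensorProduct.equivOfCompatibleSMul S R S C N).toAddEquiv)
      (f₁₂ := (LinearMap.rTensor N d').toAddMonoidHom)
      (f₂₃ := (LinearMap.rTensor N d).toAddMonoidHom)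
      (g₁₂ := (LinearMap.rTensor N (d'.restrictScalars S)).toAddMonoidHom)
      (g₂₃ := (LinearMap.rTensor N (d.restrictScalars S)).toAddMonoidHom) ?_ ?_).1 (H N)
    · ext x; induction x with
      | zero => simp
      | tmul x y => rfl
      | add x y hx hy => rw [map_add, map_add, hx, hy]
    · ext x; induction x with
      | zero => simp
      | tmul x y => rfl
      | add x y hx hy => rw [map_add, map_add, hx, hy]
  · intro H N _ _
    refine (Function.Exact.iff_of_ladder_addEquiv
      (e₁ := (TensorProduct.AlgebraTensorModule.cancelBaseChange S R R A N).symm.toAddEquiv)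
      (e₂ := (TensorProduct.AlgebraTensorModule.cancelBaseChange S R R B N).symm.toAddEquiv)
      (e₃ := (TensorProduct.AlgebraTensorModule.cancelBaseChange S R R C N).symm.toAddEquiv)
      (f₁₂ := (LinearMap.rTensor N (d'.restrictScalars S)).toAddMonoidHom)
      (f₂₃ := (LinearMap.rTensor N (d.restrictScalars S)).toAddMonoidHom)
      (g₁₂ := (LinearMap.rTensor (R ⊗[S] N) d').toAddMonoidHom)
      (g₂₃ := (LinearMap.rTensor (R ⊗[S] N) d).toAddMonoidHom) ?_ ?_).1 (H (R ⊗[S] N))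
    · ext x; induction x with
      | zero => simp
      | tmul x y => rfl
      | add x y hx hy => rw [map_add, map_add, hx, hy]
    · ext x; induction x with
      | zero => simp
      | tmul x y => rfl
      | add x y hx hy => rw [map_add, map_add, hx, hy]

theorem fdLE_restrict {S R : Type u} [CommRing S] [CommRing R] (f : S →+* R)
    (hf : Function.Surjective f) (hp : letI := f.toAlgebra; Module.Projective S R)
    (M : ModuleCat.{u} R) (n : ℕ) :
    fdLE S ((ModuleCat.restrictScalars.{u} f).obj M) n ↔ fdLE R M n := by
  have := restrict_preservesProj f hp
  have P := projectiveResolution M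
  rw [fdLE_iff_aux R M P, fdLE_iff_aux S _
    ((ModuleCat.restrictScalars.{u} f).mapProjectiveResolution P)]
  let := f.toAlgebra
  let inst (k : ℕ) : Module S (P.complex.X k) := Module.compHom _ f
  have tow (k : ℕ) : IsScalarTower S R (P.complex.X k) := ⟨fun a b c => by
      change (f a * b) • c = f a • b • c
      rw [mul_smul]⟩
  have := exact_tensor_iff_aux (S := S) (R := R) hf _ _ _ (P.complex.d (n + 2) (n + 1)).hom
    (P.complex.d (n + 1) n).hom
  constructor
  · intro H N
    exact this.1 (fun N _ _ => H (ModuleCat.of S N)) N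
  · intro H N
    exact this.2 (fun N _ _ => H (ModuleCat.of R N)) N

theorem fdLE_retract {S : Type u} [CommRing S] (M N : ModuleCat.{u} S) (n : ℕ)
    (i : N ⟶ M) (p : M ⟶ N) (h : i ≫ p = 𝟙 N) (hM : fdLE S M n) : fdLE S N n := by
  intro X
  have hz := hM X
  rw [IsZero.iff_id_eq_zero]
  have := congrArg (fun g => ((Tor' (ModuleCat.{u} S) (n + 1)).map g).app X) h
  have h2 : ((Tor' (ModuleCat.{u} S) (n + 1)).map i).app X = 0 := hz.eq_of_tgt _ _
  simp only [Functor.map_comp, NatTrans.comp_app, h2, zero_comp] at this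
  rw [CategoryTheory.Functor.map_id] at this
  exact this.symm

theorem leftDerived_additive_aux {C D : Type*} [Category* C] [Category* D] [Abelian C]
    [HasProjectiveResolutions C] [Abelian D] (F : C ⥤ D) [F.Additive] (n : ℕ) :
    (F.leftDerived n).Additive where
  map_add {X Y f g} := by
    let P := projectiveResolution X
    let Q := projectiveResolution Y
    have hf := ProjectiveResolution.lift_commutes f P Q
    have hg := ProjectiveResolution.lift_commutes g P Q
    rw [F.leftDerived_map_eq n f _ hf, F.leftDerived_map_eq n g _ hg,
      F.leftDerived_map_eq n (f + g)
        (ProjectiveResolution.lift f P Q + ProjectiveResolution.lift g P Q)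
        (by rw [Preadditive.add_comp, hf, hg, Functor.map_add, Preadditive.comp_add])]
    rw [Functor.map_add, Preadditive.add_comp, Preadditive.comp_add]

theorem pdLE_of_sum {S : Type u} [CommRing S] {ι : Type} [Fintype ι] (M : ModuleCat.{u} S)
    (N : ι → ModuleCat.{u} S) (n : ℕ)
    (p : ∀ i, M ⟶ N i) (q : ∀ i, N i ⟶ M) (h : ∑ i, p i ≫ q i = 𝟙 M)
    (hN : ∀ i, pdLE S (N i) n) : pdLE S M n := by
  intro X
  let T := ((linearYoneda S (ModuleCat.{u} S)).obj X).rightOp.leftDerived (n + 1)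
  have hT (Y : ModuleCat.{u} S) : IsZero (((Ext S (ModuleCat.{u} S) (n + 1)).obj
      (Opposite.op Y)).obj X) ↔ IsZero (T.obj Y) :=
    ⟨fun h => h.op, fun h => h.unop⟩
  have : T.Additive := leftDerived_additive_aux _ _
  refine (hT M).2 ?_
  rw [IsZero.iff_id_eq_zero, ← T.map_id, ← h, Functor.map_sum]
  refine Finset.sum_eq_zero fun i _ => ?_
  rw [T.map_comp, ((hT _).1 (hN i X)).eq_of_tgt (T.map (p i)) 0, zero_comp]

theorem pi_proj_aux {m : ℕ} (R : Fin m → Type u) [∀ i, CommRing (R i)] (i : Fin m) :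
    let := (Pi.evalRingHom R i).toAlgebra; Module.Projective (∀ i, R i) (R i) := by
  let := (Pi.evalRingHom R i).toAlgebra
  refine Module.Projective.of_split (M := ∀ i, R i)
    { toFun := fun r => Pi.single i r, map_add' := fun a b => Pi.single_add i a b,
      map_smul' := fun s r => ?_ }
    { toFun := fun r : (∀ i, R i) => r i, map_add' := fun a b => rfl,
      map_smul' := fun (s r : ∀ i, R i) => rfl } ?_
  · change Pi.single i (s i * r) = s * Pi.single i r
    ext j
    by_cases h : j = i
    · subst h; simp
    · simp [h]
  · ext x
    exact Pi.single_eq_same (M := R) i x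

open TensorProduct in
theorem pi_retract_aux {m : ℕ} (R : Fin m → Type u) [∀ i, CommRing (R i)] (i : Fin m)
    (M : ModuleCat.{u} (∀ i, R i)) :
    ∃ (N : ModuleCat.{u} (R i))
      (p : M ⟶ (ModuleCat.restrictScalars.{u} (Pi.evalRingHom R i)).obj N)
      (q : (ModuleCat.restrictScalars.{u} (Pi.evalRingHom R i)).obj N ⟶ M),
      q ≫ p = 𝟙 _ ∧ ∀ x, (p ≫ q) x = (Pi.single i (1 : R i) : ∀ i, R i) • x := by
  let := (Pi.evalRingHom R i).toAlgebra
  have hs (s : ∀ i, R i) (r : R i) :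
      (Pi.single i (s • r) : ∀ i, R i) = s * Pi.single i r := by
    change Pi.single i (s i * r) = s * Pi.single i r
    ext j
    by_cases h : j = i
    · subst h; simp
    · simp [h]
  let b : R i →ₗ[∀ i, R i] M →ₗ[∀ i, R i] M := LinearMap.mk₂ _
    (fun r x => (Pi.single i r : ∀ i, R i) • x)
    (fun a b x => by rw [Pi.single_add, add_smul])
    (fun s a x => by rw [hs, mul_smul])
    (fun a x y => smul_add _ _ _)
    (fun s a x => smul_comm _ _ _)
  let N := ModuleCat.of (R i) (R i ⊗[∀ i, R i] M)
  let F := ModuleCat.restrictScalars.{u} (Pi.evalRingHom R i)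
  have hsm (s : ∀ i, R i) (x : R i ⊗[∀ i, R i] M) : s • x = s i • x := by
    exact (algebraMap_smul (R i) s x).symm
  let p : M →ₗ[∀ i, R i] F.obj N :=
    { toFun := fun x => (1 : R i) ⊗ₜ[∀ i, R i] x
      map_add' := fun x y => TensorProduct.tmul_add _ _ _
      map_smul' := fun s x => (TensorProduct.tmul_smul s _ _).trans (hsm _ _) }
  let q : F.obj N →ₗ[∀ i, R i] M :=
    { toFun := fun x => TensorProduct.lift b x
      map_add' := fun x y => map_add (TensorProduct.lift b) x y
      map_smul' := fun s x => by
        refine Eq.trans ?_ (map_smul (TensorProduct.lift b) s x)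
        exact congrArg (TensorProduct.lift b) (hsm s x).symm }
  refine ⟨N, ModuleCat.ofHom p, ModuleCat.ofHom q, ?_, fun x => ?_⟩
  · ext x
    change (1 : R i) ⊗ₜ[∀ i, R i] (TensorProduct.lift b x) = x
    change R i ⊗[∀ i, R i] M at x
    induction x with
    | zero => simp
    | add x y hx hy => rw [map_add, TensorProduct.tmul_add, hx, hy]
    | tmul r x =>
      change (1 : R i) ⊗ₜ[∀ i, R i] ((Pi.single i r : ∀ i, R i) • x) = _
      rw [← TensorProduct.smul_tmul]
      congr 1
      change (Pi.single i r : ∀ i, R i) i * 1 = r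
      simp
  · rfl

theorem strongNPerfect_pi_iff
    (m : ℕ) (R : Fin m → Type u) [∀ i, CommRing (R i)] (n : ℕ) :
    IsStrongNPerfect (∀ i, R i) n ↔ ∀ i, IsStrongNPerfect (R i) n := by
  have hsurj (i : Fin m) : Function.Surjective (Pi.evalRingHom R i) :=
    Function.surjective_eval i
  constructor
  · intro H i M _ _ hM
    have h1 := (fdLE_restrict _ (hsurj i) (pi_proj_aux R i) (ModuleCat.of (R i) M) n).2 hM
    exact (pdLE_restrict _ (hsurj i) (pi_proj_aux R i) (ModuleCat.of (R i) M) n).1 (H _ h1)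
  · intro H M _ _ hM
    choose N p q hqp hpq using fun i => pi_retract_aux R i (ModuleCat.of (∀ i, R i) M)
    refine pdLE_of_sum (ModuleCat.of (∀ i, R i) M) _ n p q ?_ fun i => ?_
    · ext x
      rw [ModuleCat.hom_sum, LinearMap.sum_apply]
      have : ∀ i, (p i ≫ q i).hom x = (Pi.single i (1 : R i) : ∀ i, R i) • x :=
        fun i => hpq i x
      simp only [this]
      rw [← Finset.sum_smul]
      have h1 : ∑ i, (Pi.single i (1 : R i) : ∀ i, R i) = 1 :=
        Finset.univ_sum_single (1 : ∀ i, R i)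
      rw [h1, one_smul]
      rfl
    · refine (pdLE_restrict _ (hsurj i) (pi_proj_aux R i) (N i) n).2 (H i _ ?_)
      refine (fdLE_restrict _ (hsurj i) (pi_proj_aux R i) (N i) n).1 ?_
      exact fdLE_retract _ _ n (q i) (p i) (hqp i) hM
end
end
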